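/- arXiv:math/0702171 — 3 statements merged into one kernel-verified Lean document; each statement's English description precedes it below -/
import Mathlib

section
/- Let n ≥ 3, m ≥ 2, and let u be a smooth solution of Δᵐu = 0 in Ω\{x₀} for a domain Ω ⊂ ℝⁿ containing x₀. If |Δᵏu(x)| = o(|x - x₀|^{2-n}) as |x - x₀| → 0 for every k = 0, 1, ..., m-1, then u has a removable singularity at x₀, i.e., there exist δ > 0 with closure(B_δ(x₀)) ⊂ Ω and a smooth function v on B_δ(x₀) with Δᵐv = 0 such that u = v on B_δ(x₀)\{x₀}. -/
open Metric Filter MeasureTheory Asymptotics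
open scoped Topology

/-- Euclidean space ℝⁿ. -/
abbrev E (n : ℕ) := EuclideanSpace ℝ (Fin n)

/-- The Laplacian of a function on ℝⁿ. -/
noncomputable def lap {n : ℕ} (f : E n → ℝ) : E n → ℝ := fun x =>
  ∑ i : Fin n, fderiv ℝ (fun y => fderiv ℝ f y (EuclideanSpace.single i 1)) x
    (EuclideanSpace.single i 1)


/-- Partial derivative in direction `i`. -/
noncomputable def pd {n : ℕ} (i : Fin n) (f : E n → ℝ) : E n → ℝ := fun x =>
  fderiv ℝ f x (EuclideanSpace.single i 1)

lemma lap_eq_pd {n : ℕ} (f : E n → ℝ) (x : E n) : lap f x = ∑ i, pd i (pd i f) x := rfl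

lemma pd_contDiffOn {n : ℕ} (i : Fin n) {f : E n → ℝ} {s : Set (E n)} (hs : IsOpen s)
    (hf : ContDiffOn ℝ (⊤ : ℕ∞) f s) : ContDiffOn ℝ (⊤ : ℕ∞) (pd i f) s :=
  (hf.fderiv_of_isOpen hs (by simp)).clm_apply contDiffOn_const

lemma pd_contDiff {n : ℕ} (i : Fin n) {f : E n → ℝ}
    (hf : ContDiff ℝ (⊤ : ℕ∞) f) : ContDiff ℝ (⊤ : ℕ∞) (pd i f) :=
  contDiffOn_univ.1 (pd_contDiffOn i isOpen_univ hf.contDiffOn)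

lemma lap_contDiffOn {n : ℕ} {f : E n → ℝ} {s : Set (E n)} (hs : IsOpen s)
    (hf : ContDiffOn ℝ (⊤ : ℕ∞) f s) : ContDiffOn ℝ (⊤ : ℕ∞) (lap f) s := by
  have : lap f = fun x => ∑ i, pd i (pd i f) x := rfl
  rw [this]
  exact ContDiffOn.sum fun i _ => pd_contDiffOn i hs (pd_contDiffOn i hs hf)

lemma lap_contDiff {n : ℕ} {f : E n → ℝ}
    (hf : ContDiff ℝ (⊤ : ℕ∞) f) : ContDiff ℝ (⊤ : ℕ∞) (lap f) :=
  contDiffOn_univ.1 (lap_contDiffOn isOpen_univ hf.contDiffOn)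

lemma lap_iter_contDiffOn {n : ℕ} {f : E n → ℝ} {s : Set (E n)} (hs : IsOpen s)
    (hf : ContDiffOn ℝ (⊤ : ℕ∞) f s) (k : ℕ) : ContDiffOn ℝ (⊤ : ℕ∞) (lap^[k] f) s := by
  induction k with
  | zero => simpa using hf
  | succ k ih => rw [Function.iterate_succ_apply']; exact lap_contDiffOn hs ih

lemma pd_congr {n : ℕ} (i : Fin n) {f g : E n → ℝ} {x : E n} (h : f =ᶠ[𝓝 x] g) :
    pd i f =ᶠ[𝓝 x] pd i g := by
  filter_upwards [h.fderiv (𝕜 := ℝ)] with y hy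
  simp [pd, hy]

lemma lap_congr {n : ℕ} {f g : E n → ℝ} {x : E n} (h : f =ᶠ[𝓝 x] g) :
    lap f =ᶠ[𝓝 x] lap g := by
  have : ∀ i : Fin n, ∀ᶠ y in 𝓝 x, pd i (pd i f) y = pd i (pd i g) y :=
    fun i => pd_congr i (pd_congr i h)
  filter_upwards [eventually_all.2 this] with y hy
  simp only [lap_eq_pd]
  exact Finset.sum_congr rfl fun i _ => hy i

lemma lap_iter_congr {n : ℕ} {f g : E n → ℝ} {x : E n} (h : f =ᶠ[𝓝 x] g) (k : ℕ) :
    lap^[k] f =ᶠ[𝓝 x] lap^[k] g := by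
  induction k with
  | zero => simpa using h
  | succ k ih => rw [Function.iterate_succ_apply', Function.iterate_succ_apply']; exact lap_congr ih

lemma pd_mul {n : ℕ} (i : Fin n) {f g : E n → ℝ} {x : E n} (hf : DifferentiableAt ℝ f x)
    (hg : DifferentiableAt ℝ g x) :
    pd i (fun y => f y * g y) x = f x * pd i g x + g x * pd i f x := by
  simp [pd, fderiv_fun_mul hf hg]

lemma lap_mul {n : ℕ} {f g : E n → ℝ} (hf : ContDiff ℝ (⊤ : ℕ∞) f)
    (hg : ContDiff ℝ (⊤ : ℕ∞) g) (x : E n) :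
    lap (fun y => f y * g y) x =
      f x * lap g x + (∑ i, 2 * (pd i f x * pd i g x) + g x * lap f x) := by
  have hd : ∀ {h : E n → ℝ}, ContDiff ℝ (⊤ : ℕ∞) h → Differentiable ℝ h :=
    fun h => h.differentiable (by simp)
  simp only [lap_eq_pd, Finset.mul_sum, ← Finset.sum_add_distrib]
  refine Finset.sum_congr rfl fun i _ => ?_
  have h1 : pd i (fun y => f y * g y) = fun y => f y * pd i g y + g y * pd i f y := by
    ext y; exact pd_mul i (hd hf y) (hd hg y)
  have hpf := hd (pd_contDiff i hf)
  have hpg := hd (pd_contDiff i hg)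
  have h2 : pd i (fun y => f y * pd i g y + g y * pd i f y) x
      = pd i (fun y => f y * pd i g y) x + pd i (fun y => g y * pd i f y) x := by
    have := fderiv_fun_add ((hd hf x).mul (hpg x)) ((hd hg x).mul (hpf x))
    simp only [pd] at this ⊢
    erw [this]; rfl
  rw [h1, h2, pd_mul i (hd hf x) (hpg x), pd_mul i (hd hg x) (hpf x)]
  ring

lemma mul_cont {n : ℕ} {a b : E n → ℝ} {U : Set (E n)} (hU : IsOpen U) (ha : ContinuousOn a U)
    (hb : Continuous b) (hs : tsupport b ⊆ U) : Continuous (fun x => a x * b x) := by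
  apply continuous_of_tsupport
  intro x hx
  have : x ∈ tsupport b := closure_mono (Function.support_mul_subset_right a b) hx
  exact (ha.continuousAt (hU.mem_nhds (hs this))).mul hb.continuousAt

lemma pd_tsupport {n : ℕ} (i : Fin n) (f : E n → ℝ) : tsupport (pd i f) ⊆ tsupport f :=
  tsupport_fderiv_apply_subset ℝ _

lemma pd_compact {n : ℕ} (i : Fin n) {f : E n → ℝ} (h : HasCompactSupport f) :
    HasCompactSupport (pd i f) := h.fderiv_apply (𝕜 := ℝ) _

lemma ibp1 {n : ℕ} (i : Fin n) {a b : E n → ℝ} {U : Set (E n)} (hU : IsOpen U)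
    (ha : ContDiffOn ℝ (⊤ : ℕ∞) a U) (hac : HasCompactSupport a)
    (hb : ContDiff ℝ (⊤ : ℕ∞) b) (hs : tsupport b ⊆ U) :
    ∫ x, a x * pd i b x = - ∫ x, pd i a x * b x := by
  apply integral_mul_fderiv_eq_neg_fderiv_mul_of_integrable
  · exact (mul_cont hU (pd_contDiffOn i hU ha).continuousOn hb.continuous
      hs).integrable_of_hasCompactSupport ((pd_compact i hac).mul_right)
  · exact (mul_cont hU ha.continuousOn (pd_contDiff i hb).continuous
      ((pd_tsupport i b).trans hs)).integrable_of_hasCompactSupport (hac.mul_right)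
  · exact (mul_cont hU ha.continuousOn hb.continuous
      hs).integrable_of_hasCompactSupport (hac.mul_right)
  · intro x hx
    exact (ha.contDiffAt (hU.mem_nhds (hs hx))).differentiableAt (by simp)
  · intro x _
    exact hb.differentiable (by simp) x

lemma ibp2 {n : ℕ} {a b : E n → ℝ} {U : Set (E n)} (hU : IsOpen U)
    (ha : ContDiffOn ℝ (⊤ : ℕ∞) a U) (hac : HasCompactSupport a)
    (hb : ContDiff ℝ (⊤ : ℕ∞) b) (hs : tsupport b ⊆ U) :
    ∫ x, a x * lap b x = ∫ x, lap a x * b x := by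
  simp only [lap_eq_pd, Finset.mul_sum, Finset.sum_mul]
  rw [integral_finsetSum, integral_finsetSum]
  · refine Finset.sum_congr rfl fun i _ => ?_
    rw [ibp1 i hU ha hac (pd_contDiff i hb) ((pd_tsupport i b).trans hs),
      ibp1 i hU (pd_contDiffOn i hU ha) (pd_compact i hac) hb hs, neg_neg]
  · intro i _
    exact (mul_cont hU (pd_contDiffOn i hU (pd_contDiffOn i hU ha)).continuousOn hb.continuous
      hs).integrable_of_hasCompactSupport ((pd_compact i (pd_compact i hac)).mul_right)
  · intro i _
    exact (mul_cont hU ha.continuousOn (pd_contDiff i (pd_contDiff i hb)).continuous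
      ((pd_tsupport i _).trans ((pd_tsupport i b).trans hs))).integrable_of_hasCompactSupport
        (hac.mul_right)

lemma pd_scale {n : ℕ} (i : Fin n) (b : E n → ℝ) (c : ℝ) (x₀ x : E n) :
    pd i (fun y => b (c • (y - x₀))) x = c * pd i b (c • (x - x₀)) := by
  have := fderiv_comp_sub (𝕜 := ℝ) (f := fun y => b (c • y)) (x := x) x₀
  simp only [pd]
  rw [this, fderiv_comp_smul]
  rfl

lemma pd_const_mul {n : ℕ} (i : Fin n) (b : E n → ℝ) (c : ℝ) (x : E n) :
    pd i (fun y => c * b y) x = c * pd i b x := by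
  have h2 : (fun y => c * b y) = (c • b) := rfl
  simp only [pd]
  rw [h2, fderiv_const_smul_field]
  rfl

lemma pd_one_sub {n : ℕ} (i : Fin n) (b : E n → ℝ) (x : E n) :
    pd i (fun y => 1 - b y) x = - pd i b x := by
  simp [pd, fderiv_const_sub]

lemma nontriv {n : ℕ} (hn : 3 ≤ n) : Nontrivial (E n) := by
  have : Nonempty (Fin n) := ⟨⟨0, by omega⟩⟩
  infer_instance

lemma norm_rpow_intBall {n : ℕ} (hn : 3 ≤ n) (r : ℝ) :
    IntegrableOn (fun x : E n => ‖x‖ ^ ((2 : ℝ) - n)) (ball 0 r) := by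
  have := nontriv hn
  rw [integrableOn_fun_norm_addHaar volume (f := fun t : ℝ => t ^ ((2 : ℝ) - n))]
  have : IntegrableOn (fun y : ℝ => y) (Set.Ioo 0 r) :=
    (continuous_id.integrableOn_Icc (a := 0) (b := r)).mono_set Set.Ioo_subset_Icc_self
  refine this.congr_fun (fun y hy => ?_) measurableSet_Ioo
  have hy0 : (0 : ℝ) < y := hy.1
  simp only [finrank_euclideanSpace, Fintype.card_fin, smul_eq_mul]
  rw [← Real.rpow_natCast, ← Real.rpow_add hy0, Nat.cast_sub (by omega)]
  norm_num

lemma norm_rpow_intBall' {n : ℕ} (hn : 3 ≤ n) (x₀ : E n) (r : ℝ) :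
    IntegrableOn (fun x : E n => ‖x - x₀‖ ^ ((2 : ℝ) - n)) (ball x₀ r) := by
  have h3 := norm_rpow_intBall hn r
  rw [← integrable_indicator_iff measurableSet_ball] at h3 ⊢
  refine (h3.comp_sub_right x₀).congr (Eventually.of_forall fun x => ?_)
  simp [Set.indicator, dist_eq_norm]

lemma norm_rpow_locInt' {n : ℕ} (hn : 3 ≤ n) (x₀ : E n) :
    LocallyIntegrable (fun x : E n => ‖x - x₀‖ ^ ((2 : ℝ) - n)) volume := by
  intro x
  refine ⟨ball x₀ (dist x x₀ + 1), ?_, norm_rpow_intBall' hn _ _⟩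
  exact isOpen_ball.mem_nhds (by simp)

lemma norm_rpow_locInt {n : ℕ} (hn : 3 ≤ n) :
    LocallyIntegrable (fun x : E n => ‖x‖ ^ ((2 : ℝ) - n)) volume := by
  intro x
  refine ⟨ball 0 (‖x‖ + 1), ?_, norm_rpow_intBall hn _⟩
  exact isOpen_ball.mem_nhds (by simp)

lemma f_integrable {n : ℕ} (hn : 3 ≤ n) {f : E n → ℝ} {x₀ : E n}
    (hf : ContinuousOn f {x₀}ᶜ) (hfc : HasCompactSupport f)
    (ho : f =o[𝓝[≠] x₀] fun x => ‖x - x₀‖ ^ ((2 : ℝ) - n)) : Integrable f := by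
  have := nontriv hn
  have hm : AEStronglyMeasurable f volume := by
    have := hf.aestronglyMeasurable (μ := volume) (measurableSet_singleton x₀).compl
    rwa [restrict_compl_singleton] at this
  have h1 := ho.bound (c := 1) one_pos
  rw [eventually_nhdsWithin_iff, Metric.eventually_nhds_iff_ball] at h1
  obtain ⟨r, hr, h1⟩ := h1
  rw [← integrableOn_univ, ← Set.union_compl_self (ball x₀ r)]
  refine IntegrableOn.union ?_ ?_
  · have h2 : IntegrableOn (fun x : E n => ‖x - x₀‖ ^ ((2 : ℝ) - n)) (ball x₀ r) :=
      norm_rpow_intBall' hn x₀ r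
    refine Integrable.mono' h2 hm.restrict ?_
    rw [← restrict_compl_singleton x₀ (μ := volume), Measure.restrict_restrict measurableSet_ball]
    rw [ae_restrict_iff' (measurableSet_ball.inter (measurableSet_singleton _).compl)]
    refine Eventually.of_forall fun x hx => ?_
    have := h1 x hx.1 hx.2
    rw [one_mul, Real.norm_of_nonneg (by positivity : 0 ≤ ‖x - x₀‖ ^ ((2 : ℝ) - n))] at this
    exact this
  · have h4 : IntegrableOn f (tsupport f ∩ (ball x₀ r)ᶜ) := by
      refine ContinuousOn.integrableOn_compact (hfc.isCompact.inter_right isOpen_ball.isClosed_compl)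
        (hf.mono ?_)
      rintro x ⟨_, hx⟩ rfl
      exact hx (mem_ball_self hr)
    refine h4.of_forall_sdiff_eq_zero isOpen_ball.measurableSet.compl fun x hx => ?_
    by_contra h
    exact hx.2 ⟨subset_tsupport f h, hx.1⟩

/-- Bounds for a fixed cutoff. -/
lemma cutoff_bounds (n : ℕ) : ∃ b : E n → ℝ, ∃ C : ℝ, 0 ≤ C ∧ ContDiff ℝ (⊤ : ℕ∞) b ∧
    (∀ z, 0 ≤ b z ∧ b z ≤ 1) ∧ (∀ z, ‖z‖ ≤ 1 → b z = 1) ∧ (∀ z, 2 ≤ ‖z‖ → b z = 0) ∧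
    (∀ i z, |pd i b z| ≤ C) ∧ (∀ z, |lap b z| ≤ C) ∧
    (∀ i z, ‖z‖ < 1 ∨ 2 < ‖z‖ → pd i b z = 0) ∧ (∀ z, ‖z‖ < 1 ∨ 2 < ‖z‖ → lap b z = 0) := by
  let b : ContDiffBump (0 : E n) := ⟨1, 2, one_pos, one_lt_two⟩
  have hb : ContDiff ℝ (⊤ : ℕ∞) b := b.contDiff
  have hbd : ∀ F : E n → ℝ, Continuous F → HasCompactSupport F → ∃ C, ∀ x, |F x| ≤ C := by
    intro F h1 h2
    exact h1.bounded_above_of_compact_support h2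
  choose C hC using fun i : Fin n => hbd (pd i b) (pd_contDiff i hb).continuous
    (pd_compact i b.hasCompactSupport)
  have h1 : ∀ z : E n, ‖z‖ ≤ 1 → b z = 1 := fun z hz =>
    b.one_of_mem_closedBall (by simpa [b] using hz)
  have h2 : ∀ z : E n, 2 ≤ ‖z‖ → b z = 0 := fun z hz =>
    b.zero_of_le_dist (by simpa [b] using hz)
  have hloc : ∀ z : E n, ‖z‖ < 1 ∨ 2 < ‖z‖ → ∃ c : ℝ, (b : E n → ℝ) =ᶠ[𝓝 z] fun _ => c := by
    rintro z (hz | hz)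
    · refine ⟨1, ?_⟩
      filter_upwards [continuous_norm.continuousAt.eventually_lt continuousAt_const hz] with y hy
      exact h1 y hy.le
    · refine ⟨0, ?_⟩
      filter_upwards [continuousAt_const.eventually_lt continuous_norm.continuousAt hz] with y hy
      exact h2 y hy.le
  have hpc : ∀ (i : Fin n) (c : ℝ), pd i (fun _ => c) = fun _ => 0 := by
    intro i c; ext z; simp [pd]
  have hlc : ∀ (c : ℝ) z, lap (n := n) (fun _ => c) z = 0 := by
    intro c z; simp [lap_eq_pd, hpc]
  have hlapc : HasCompactSupport (lap (b : E n → ℝ)) := by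
    refine HasCompactSupport.intro (isCompact_closedBall (0 : E n) 2) fun z hz => ?_
    obtain ⟨c, hc⟩ := hloc z (Or.inr (by simpa using hz))
    rw [(lap_congr hc).eq_of_nhds, hlc]
  obtain ⟨C', hC'⟩ := hbd (lap b) (lap_contDiff hb).continuous hlapc
  refine ⟨b, ∑ i, |C i| + |C'|, by positivity, hb, fun z => ⟨b.nonneg, b.le_one⟩, h1, h2, ?_, ?_, ?_, ?_⟩
  · intro i z
    have := Finset.single_le_sum (f := fun i => |C i|) (fun i _ => abs_nonneg _) (Finset.mem_univ i)
    have h3 := (hC i z).trans (le_abs_self _)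
    have h4 := abs_nonneg C'
    linarith
  · intro z
    have : 0 ≤ ∑ i, |C i| := by positivity
    have h3 := (hC' z).trans (le_abs_self _)
    linarith
  · intro i z hz
    obtain ⟨c, hc⟩ := hloc z hz
    rw [(pd_congr i hc).eq_of_nhds, hpc]
  · intro z hz
    obtain ⟨c, hc⟩ := hloc z hz
    rw [(lap_congr hc).eq_of_nhds, hlc]

lemma int_mul {n : ℕ} {f φ : E n → ℝ} (hf : Integrable f) (hfc : HasCompactSupport f)
    (hφ : Continuous φ) : Integrable (fun x => f x * φ x) := by
  have h1 : IntegrableOn (fun x => f x * φ x) (tsupport f) :=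
    hf.integrableOn.mul_continuousOn hφ.continuousOn hfc.isCompact
  rwa [integrableOn_iff_integrable_of_support_subset] at h1
  exact (Function.support_mul_subset_left f φ).trans (subset_tsupport f)

lemma eta_limit {n : ℕ} (hn : 3 ≤ n) {b : E n → ℝ} (hb : Continuous b)
    (hb01 : ∀ z, 0 ≤ b z ∧ b z ≤ 1) (hb2 : ∀ z, 2 ≤ ‖z‖ → b z = 0) (x₀ : E n) {F : E n → ℝ}
    (hF : Integrable F) :
    Tendsto (fun ε : ℝ => ∫ y, F y * (1 - b (ε⁻¹ • (y - x₀)))) (𝓝[>] 0) (𝓝 (∫ y, F y)) := by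
  have := nontriv hn
  refine tendsto_integral_filter_of_dominated_convergence (fun y => |F y|) ?_ ?_ hF.abs ?_
  · refine Eventually.of_forall fun ε => ?_
    refine hF.aestronglyMeasurable.mul (Continuous.aestronglyMeasurable ?_)
    fun_prop
  · refine Eventually.of_forall fun ε => Eventually.of_forall fun y => ?_
    have h := hb01 (ε⁻¹ • (y - x₀))
    rw [norm_mul, Real.norm_eq_abs, Real.norm_eq_abs]
    refine mul_le_of_le_one_right (abs_nonneg _) ?_
    rw [abs_le]; constructor <;> linarith
  · have hne : ∀ᵐ y : E n, y ≠ x₀ := by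
      simp [ae_iff]
    filter_upwards [hne] with y hy
    have hpos : 0 < ‖y - x₀‖ := norm_pos_iff.2 (sub_ne_zero.2 hy)
    refine tendsto_const_nhds.congr' ?_
    filter_upwards [Ioo_mem_nhdsGT (show (0 : ℝ) < ‖y - x₀‖ / 2 by linarith)] with ε hε
    rw [hb2, sub_zero, mul_one]
    rw [norm_smul, norm_inv, Real.norm_of_nonneg hε.1.le, inv_mul_eq_div, le_div_iff₀ hε.1]
    have := hε.2
    linarith

lemma weak {n : ℕ} (hn : 3 ≤ n) {f g ψ : E n → ℝ} {x₀ : E n}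
    (hf : ContDiffOn ℝ (⊤ : ℕ∞) f {x₀}ᶜ) (hfc : HasCompactSupport f)
    (ho : f =o[𝓝[≠] x₀] fun x => ‖x - x₀‖ ^ ((2 : ℝ) - n))
    (hg : Continuous g) (hgc : HasCompactSupport g) (hfg : ∀ x, x ≠ x₀ → lap f x = g x)
    (hψ : ContDiff ℝ (⊤ : ℕ∞) ψ) :
    ∫ x, f x * lap ψ x = ∫ x, g x * ψ x := by
  have := nontriv hn
  obtain ⟨b, C, hC0, hb, hb01, hb1, hb2, hbp, hbl, hbp0, hbl0⟩ := cutoff_bounds n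
  have hfi : Integrable f := f_integrable hn hf.continuousOn hfc ho
  have hgi : Integrable g := hg.integrable_of_hasCompactSupport hgc
  let η : ℝ → E n → ℝ := fun ε y => 1 - b (ε⁻¹ • (y - x₀))
  let D : ℝ → E n → ℝ := fun ε y =>
    ∑ i, 2 * (pd i (η ε) y * pd i ψ y) + ψ y * lap (η ε) y
  have hη : ∀ ε, ContDiff ℝ (⊤ : ℕ∞) (η ε) := fun ε => by
    refine contDiff_const.sub (hb.comp ?_)
    fun_prop
  have hDc : ∀ ε, Continuous (D ε) := fun ε => by
    refine Continuous.add (continuous_finsetSum _ fun i _ => ?_) ?_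
    · exact continuous_const.mul
        ((pd_contDiff i (hη ε)).continuous.mul (pd_contDiff i hψ).continuous)
    · exact hψ.continuous.mul (lap_contDiff (hη ε)).continuous
  have hpη : ∀ ε i, pd i (η ε) = fun y => - (ε⁻¹ * pd i b (ε⁻¹ • (y - x₀))) := by
    intro ε i
    ext y
    simp only [η]
    rw [pd_one_sub, pd_scale]
  have hlη : ∀ ε y, lap (η ε) y = - (ε⁻¹ * (ε⁻¹ * lap b (ε⁻¹ • (y - x₀)))) := by
    intro ε y
    simp only [lap_eq_pd, Finset.mul_sum, ← Finset.sum_neg_distrib]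
    refine Finset.sum_congr rfl fun i _ => ?_
    rw [hpη]
    have : (fun y => - (ε⁻¹ * pd i b (ε⁻¹ • (y - x₀))))
      = fun y => (-ε⁻¹) * (fun y => pd i b (ε⁻¹ • (y - x₀))) y := by ext y; ring
    rw [this, pd_const_mul, pd_scale]
    ring
  have key : ∀ ε, 0 < ε → (∫ y, (f y * lap ψ y) * η ε y) + ∫ y, f y * D ε y
      = ∫ y, (g y * ψ y) * η ε y := by
    intro ε hε
    have hz : ∀ᶠ y in 𝓝 x₀, η ε y = 0 := by
      filter_upwards [closedBall_mem_nhds x₀ hε] with y hy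
      simp only [η]
      rw [hb1, sub_self]
      rw [norm_smul, norm_inv, Real.norm_of_nonneg hε.le, inv_mul_eq_div, div_le_one hε]
      simpa [dist_eq_norm] using hy
    have hs : tsupport (fun y => η ε y * ψ y) ⊆ {x₀}ᶜ := by
      rintro y hy rfl
      revert hy
      change ¬ _
      rw [notMem_tsupport_iff_eventuallyEq]
      filter_upwards [hz] with z hz
      simp [hz]
    have h1 := ibp2 isOpen_compl_singleton hf hfc ((hη ε).mul hψ) hs
    have h2 : ∀ y, lap f y * (η ε y * ψ y) = (g y * ψ y) * η ε y := by
      intro y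
      by_cases hy : y = x₀
      · rw [hy, hz.self_of_nhds]; simp
      · rw [hfg y hy]; ring
    have h3 : ∀ y, f y * lap (fun y => η ε y * ψ y) y
        = (f y * lap ψ y) * η ε y + f y * D ε y := by
      intro y
      rw [lap_mul (hη ε) hψ]
      simp only [D]
      ring
    simp only [h2, h3] at h1
    rw [← h1, integral_add]
    · have := int_mul hfi hfc ((lap_contDiff hψ).continuous.mul (hη ε).continuous)
      simpa only [mul_assoc, Pi.mul_apply] using this
    · exact int_mul hfi hfc (hDc ε)
  have lim1 := eta_limit hn hb.continuous hb01 hb2 x₀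
    (int_mul hfi hfc (lap_contDiff hψ).continuous)
  have lim2 := eta_limit hn hb.continuous hb01 hb2 x₀ (int_mul hgi hgc hψ.continuous)
  have lim3 : Tendsto (fun ε => ∫ y, f y * D ε y) (𝓝[>] 0) (𝓝 0) := by
    -- bounds for `ψ`
    obtain ⟨M, hM0, hM1, hM2⟩ : ∃ M : ℝ, 0 ≤ M ∧ (∀ y ∈ closedBall x₀ 2, |ψ y| ≤ M) ∧
        ∀ i, ∀ y ∈ closedBall x₀ 2, |pd i ψ y| ≤ M := by
      obtain ⟨M1, h1⟩ := (isCompact_closedBall x₀ 2).exists_bound_of_continuousOn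
        hψ.continuous.continuousOn
      choose M2 h2 using fun i => (isCompact_closedBall x₀ 2).exists_bound_of_continuousOn
        (pd_contDiff i hψ).continuous.continuousOn
      refine ⟨|M1| + ∑ i, |M2 i|, by positivity, fun y hy => ?_, fun i y hy => ?_⟩
      · have h3 := (h1 y hy).trans (le_abs_self _)
        have : 0 ≤ ∑ i, |M2 i| := by positivity
        rw [Real.norm_eq_abs] at h3
        linarith
      · have h3 := (h2 i y hy).trans (le_abs_self _)
        have := Finset.single_le_sum (f := fun i => |M2 i|) (fun i _ => abs_nonneg _)
          (Finset.mem_univ i)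
        rw [Real.norm_eq_abs] at h3
        have := abs_nonneg M1
        linarith
    let K : ℝ := (2 * n + 1) * (C * M)
    have hK0 : 0 ≤ K := by positivity
    have hsc : ∀ ε : ℝ, 0 < ε → ∀ y, ‖ε⁻¹ • (y - x₀)‖ = ‖y - x₀‖ / ε := by
      intro ε hε y
      rw [norm_smul, norm_inv, Real.norm_of_nonneg hε.le, inv_mul_eq_div]
    have hD0 : ∀ ε, 0 < ε → ∀ y, ‖y - x₀‖ < ε ∨ 2 * ε < ‖y - x₀‖ → D ε y = 0 := by
      intro ε hε y hy
      have hy' : ‖ε⁻¹ • (y - x₀)‖ < 1 ∨ 2 < ‖ε⁻¹ • (y - x₀)‖ := by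
        rw [hsc ε hε, div_lt_one hε, lt_div_iff₀ hε]
        exact hy
      simp only [D, hpη, hlη, hbp0 _ _ hy', hbl0 _ hy']
      simp
    have hDb : ∀ ε, 0 < ε → ε ≤ 1 → ∀ y ∈ closedBall x₀ 2, |D ε y| ≤ K * (ε⁻¹ * ε⁻¹) := by
      intro ε hε hε1 y hy
      have he : 1 ≤ ε⁻¹ := (one_le_inv₀ hε).2 hε1
      have he0 : 0 < ε⁻¹ := by positivity
      have hi : ∀ i, |2 * (pd i (η ε) y * pd i ψ y)| ≤ 2 * (C * M) * (ε⁻¹ * ε⁻¹) := by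
        intro i
        rw [hpη, abs_mul, abs_mul, abs_neg, abs_mul, abs_of_pos he0, abs_two]
        calc 2 * (ε⁻¹ * |pd i b (ε⁻¹ • (y - x₀))| * |pd i ψ y|) ≤ 2 * ((ε⁻¹ * ε⁻¹) * C * M) := by
              gcongr
              · exact le_mul_of_one_le_right he0.le he
              · exact hbp _ _
              · exact hM2 i y hy
          _ = _ := by ring
      have hl : |ψ y * lap (η ε) y| ≤ (C * M) * (ε⁻¹ * ε⁻¹) := by
        rw [hlη, abs_mul, abs_neg, abs_mul, abs_mul, abs_of_pos he0]
        calc |ψ y| * (ε⁻¹ * (ε⁻¹ * |lap b (ε⁻¹ • (y - x₀))|)) ≤ M * (ε⁻¹ * (ε⁻¹ * C)) := by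
              gcongr
              · exact hM1 y hy
              · exact hbl _
          _ = _ := by ring
      calc |D ε y| ≤ |∑ i, 2 * (pd i (η ε) y * pd i ψ y)| + |ψ y * lap (η ε) y| := abs_add_le _ _
        _ ≤ ∑ i, |2 * (pd i (η ε) y * pd i ψ y)| + |ψ y * lap (η ε) y| := by
            gcongr; exact Finset.abs_sum_le_sum_abs _ _
        _ ≤ ∑ i : Fin n, 2 * (C * M) * (ε⁻¹ * ε⁻¹) + (C * M) * (ε⁻¹ * ε⁻¹) := by
            gcongr with i; exact hi i
        _ = K * (ε⁻¹ * ε⁻¹) := by simp [K]; ring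
    let V : ℝ := volume.real (closedBall (0 : E n) 1)
    have hV : 0 ≤ V := measureReal_nonneg
    let A : ℝ := K * 2 ^ n * V
    have hA : 0 ≤ A := by positivity
    rw [Metric.tendsto_nhds]
    intro δ hδ
    have hd : 0 < δ / (A + 1) := by positivity
    have h1 := ho.bound hd
    rw [eventually_nhdsWithin_iff, Metric.eventually_nhds_iff_ball] at h1
    obtain ⟨r, hr, h1⟩ := h1
    filter_upwards [Ioo_mem_nhdsGT (show (0 : ℝ) < min 1 (r / 2) by positivity)] with ε hε
    have hε0 : 0 < ε := hε.1
    have hε1 : ε < 1 := hε.2.trans_le (min_le_left _ _)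
    have hε2 : 2 * ε < r := by have := hε.2.trans_le (min_le_right _ _); linarith
    have hsub : ∫ y, f y * D ε y = ∫ y in closedBall x₀ (2 * ε), f y * D ε y := by
      rw [setIntegral_eq_integral_of_forall_compl_eq_zero]
      intro y hy
      rw [hD0 ε hε0 y, mul_zero]
      right
      simpa [dist_eq_norm] using hy
    have hbnd : ∀ y ∈ closedBall x₀ (2 * ε), ‖f y * D ε y‖ ≤ δ / (A + 1) * K * (ε ^ n)⁻¹ := by
      intro y hy
      by_cases hlt : ‖y - x₀‖ < ε
      · rw [hD0 ε hε0 y (Or.inl hlt)]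
        simp only [mul_zero, norm_zero]
        positivity
      push Not at hlt
      have hyne : y ≠ x₀ := by
        rintro rfl
        simp at hlt; linarith
      have hf1 := h1 y (closedBall_subset_ball hε2 hy) hyne
      rw [Real.norm_of_nonneg (by positivity : 0 ≤ ‖y - x₀‖ ^ ((2 : ℝ) - n))] at hf1
      have hp : ‖y - x₀‖ ^ ((2 : ℝ) - n) ≤ ε ^ ((2 : ℝ) - n) := by
        apply Real.rpow_le_rpow_of_nonpos hε0 hlt
        have : (3 : ℝ) ≤ n := by exact_mod_cast hn
        linarith
      have hp2 : ε ^ ((2 : ℝ) - n) = ε ^ 2 * (ε ^ n)⁻¹ := by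
        rw [Real.rpow_sub hε0, Real.rpow_natCast, div_eq_mul_inv]
        norm_num
      have hD1 := hDb ε hε0 hε1.le y (closedBall_subset_closedBall (by linarith) hy)
      rw [norm_mul, Real.norm_eq_abs (D ε y)]
      calc ‖f y‖ * |D ε y| ≤ (δ / (A + 1) * (ε ^ 2 * (ε ^ n)⁻¹)) * (K * (ε⁻¹ * ε⁻¹)) := by
            gcongr
            rw [← hp2]
            exact hf1.trans (by gcongr)
        _ = _ := by field_simp
    have h2 := norm_setIntegral_le_of_norm_le_const (μ := volume)
      (measure_closedBall_lt_top (x := x₀) (r := 2 * ε)) hbnd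
    rw [Measure.addHaar_real_closedBall' _ _ (by positivity)] at h2
    simp only [finrank_euclideanSpace, Fintype.card_fin] at h2
    rw [dist_zero_right, hsub]
    refine h2.trans_lt ?_
    have : δ / (A + 1) * K * (ε ^ n)⁻¹ * ((2 * ε) ^ n * V) = δ * (A / (A + 1)) := by
      simp only [A]
      rw [mul_pow]
      field_simp
    change δ / (A + 1) * K * (ε ^ n)⁻¹ * ((2 * ε) ^ n * V) < δ
    rw [this]
    have h3 : A / (A + 1) < 1 := by rw [div_lt_one (by positivity)]; linarith
    nlinarith
  have lim4 := lim1.add lim3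
  rw [add_zero] at lim4
  refine tendsto_nhds_unique lim4 (lim2.congr' ?_)
  filter_upwards [self_mem_nhdsWithin] with ε hε
  exact (key ε hε).symm

lemma reg_contDiff {n : ℕ} (x : E n) {ε : ℝ} (hε : 0 < ε) (a : ℝ) :
    ContDiff ℝ (⊤ : ℕ∞) (fun y : E n => (‖y - x‖ ^ 2 + ε ^ 2) ^ a) := by
  refine ContDiff.rpow_const_of_ne ?_ fun y => by positivity
  exact ((contDiff_id.sub contDiff_const).norm_sq ℝ).add contDiff_const

lemma pd_reg {n : ℕ} (i : Fin n) (x : E n) {ε : ℝ} (hε : 0 < ε) (a : ℝ) (y : E n) :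
    pd i (fun y : E n => (‖y - x‖ ^ 2 + ε ^ 2) ^ a) y
      = (2 * a) * ((‖y - x‖ ^ 2 + ε ^ 2) ^ (a - 1) * (y i - x i)) := by
  have h1 : HasFDerivAt (fun y : E n => ‖y - x‖ ^ 2 + ε ^ 2)
      (2 • (innerSL ℝ (y - x)).comp (ContinuousLinearMap.id ℝ (E n))) y :=
    ((hasFDerivAt_id y).sub_const x).norm_sq.add_const _
  have h2 := h1.rpow_const (p := a) (Or.inl (by positivity))
  simp only [pd]
  rw [h2.fderiv]
  simp [EuclideanSpace.inner_single_right]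
  ring

lemma lap_reg {n : ℕ} (x : E n) {ε : ℝ} (hε : 0 < ε) (y : E n) :
    lap (fun y : E n => (‖y - x‖ ^ 2 + ε ^ 2) ^ (((2 : ℝ) - n) / 2)) y
      = (n * (2 - n)) * (ε ^ 2 * (‖y - x‖ ^ 2 + ε ^ 2) ^ (-((n : ℝ) + 2) / 2)) := by
  set a : ℝ := ((2 : ℝ) - n) / 2 with ha
  set q : ℝ := ‖y - x‖ ^ 2 + ε ^ 2 with hq
  have hq0 : 0 < q := by positivity
  have h1 : ∀ i, pd i (pd i (fun y : E n => (‖y - x‖ ^ 2 + ε ^ 2) ^ a)) y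
      = (2 * a) * (q ^ (a - 1) + (2 * (a - 1)) * q ^ (a - 2) * (y i - x i) ^ 2) := by
    intro i
    have h2 : pd i (fun y : E n => (‖y - x‖ ^ 2 + ε ^ 2) ^ a)
        = fun y => (2 * a) * ((‖y - x‖ ^ 2 + ε ^ 2) ^ (a - 1) * (y i - x i)) := by
      ext y; exact pd_reg i x hε a y
    have hc : HasFDerivAt (fun y : E n => y i - x i) (EuclideanSpace.proj i : E n →L[ℝ] ℝ) y :=
      (EuclideanSpace.proj i : E n →L[ℝ] ℝ).hasFDerivAt.sub_const _
    have hp : pd i (fun y : E n => y i - x i) y = 1 := by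
      simp only [pd]
      rw [hc.fderiv]
      simp
    rw [h2, pd_const_mul i (fun y => (‖y - x‖ ^ 2 + ε ^ 2) ^ (a - 1) * (y i - x i)),
      pd_mul i ((reg_contDiff x hε (a - 1)).differentiable (by simp) y) hc.differentiableAt,
      pd_reg i x hε, hp, show a - 1 - 1 = a - 2 by ring]
    ring
  rw [lap_eq_pd]
  simp only [h1]
  have hs : ∑ i, (y i - x i) ^ 2 = q - ε ^ 2 := by
    have : ‖y - x‖ ^ 2 = ∑ i, (y i - x i) ^ 2 := by
      rw [EuclideanSpace.norm_sq_eq]; simp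
    rw [← this]; ring
  rw [← Finset.mul_sum, Finset.sum_add_distrib, ← Finset.mul_sum, hs]
  have hq1 : q ^ (a - 1) = q ^ (a - 2) * q := by
    rw [← Real.rpow_add_one hq0.ne']; congr 1; ring
  have ha2 : -((n : ℝ) + 2) / 2 = a - 2 := by rw [ha]; ring
  rw [ha2, hq1]
  simp only [Finset.sum_const, Finset.card_univ, Fintype.card_fin, nsmul_eq_mul]
  rw [ha]; ring

lemma repr_formula {n : ℕ} (hn : 3 ≤ n) : ∃ I : ℝ, I ≠ 0 ∧ ∀ {f g : E n → ℝ} {x₀ : E n}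
    (_ : ContDiffOn ℝ (⊤ : ℕ∞) f {x₀}ᶜ) (_ : HasCompactSupport f)
    (_ : f =o[𝓝[≠] x₀] fun x => ‖x - x₀‖ ^ ((2 : ℝ) - n))
    (_ : Continuous g) (_ : HasCompactSupport g) (_ : ∀ x, x ≠ x₀ → lap f x = g x)
    (x : E n), x ≠ x₀ → I * f x = ∫ y, g y * ‖y - x‖ ^ ((2 : ℝ) - n) := by
  have := nontriv hn
  have hn' : (3 : ℝ) ≤ n := by exact_mod_cast hn
  obtain ⟨ρ, hρ⟩ : ∃ ρ : E n → ℝ, ρ = fun z => (1 + ‖z‖ ^ 2) ^ (-((n : ℝ) + 2) / 2) := ⟨_, rfl⟩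
  have hρi : Integrable ρ := by rw [hρ]; exact integrable_rpow_neg_one_add_norm_sq (by simp)
  have hρ0 : ∀ z, 0 < ρ z := fun z => by rw [hρ]; positivity
  obtain ⟨J, hJdef⟩ : ∃ J, J = ∫ z, ρ z := ⟨_, rfl⟩
  have hJ : 0 < J := by
    rw [hJdef, integral_pos_iff_support_of_nonneg (fun z => (hρ0 z).le) hρi]
    have : Function.support ρ = Set.univ := by
      ext z; simp [(hρ0 z).ne']
    rw [this]
    exact Measure.measure_univ_pos.2 (NeZero.ne _)
  refine ⟨(n * (2 - n)) * J, by
    have h1 : (2 - n : ℝ) ≠ 0 := by linarith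
    have h2 : (n : ℝ) ≠ 0 := by linarith
    positivity, ?_⟩
  intro f g x₀ hf hfc ho hg hgc hfg x hx
  have hfi : Integrable f := f_integrable hn hf.continuousOn hfc ho
  have hdec : Tendsto (fun z : E n => ‖z‖ ^ (Module.finrank ℝ (E n)) * (J⁻¹ * ρ z))
      (Bornology.cobounded (E n)) (𝓝 0) := by
    have h1 : Tendsto (fun z : E n => J⁻¹ * (‖z‖ ^ 2)⁻¹) (Bornology.cobounded (E n)) (𝓝 0) := by
      have : Tendsto (fun t : ℝ => J⁻¹ * (t ^ 2)⁻¹) atTop (𝓝 0) := by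
        simpa using ((tendsto_pow_atTop (two_ne_zero)).inv_tendsto_atTop.const_mul J⁻¹)
      exact this.comp tendsto_norm_cobounded_atTop
    refine squeeze_zero' (Eventually.of_forall fun z => ?_) ?_ h1
    · have := (hρ0 z).le
      positivity
    · filter_upwards [tendsto_norm_cobounded_atTop.eventually_gt_atTop 0] with z hz
      have h2 : ρ z ≤ ‖z‖ ^ (-((n : ℝ) + 2)) := by
        have h3 : ρ z ≤ (‖z‖ ^ 2) ^ (-((n : ℝ) + 2) / 2) := by
          rw [hρ]
          apply Real.rpow_le_rpow_of_nonpos (by positivity) (by linarith) (by linarith)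
        rwa [← Real.rpow_natCast, ← Real.rpow_mul hz.le,
          show ((2 : ℕ) : ℝ) * (-((n : ℝ) + 2) / 2) = -((n : ℝ) + 2) by push_cast; ring] at h3
      rw [Real.rpow_neg hz.le, show (n : ℝ) + 2 = ((n + 2 : ℕ) : ℝ) by push_cast; ring,
        Real.rpow_natCast] at h2
      simp only [finrank_euclideanSpace, Fintype.card_fin]
      calc ‖z‖ ^ n * (J⁻¹ * ρ z) ≤ ‖z‖ ^ n * (J⁻¹ * (‖z‖ ^ (n + 2))⁻¹) := by gcongr
        _ = J⁻¹ * (‖z‖ ^ 2)⁻¹ := by rw [pow_add]; field_simp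
  have peak := tendsto_integral_comp_smul_smul_of_integrable' (μ := volume)
    (φ := fun z : E n => J⁻¹ * ρ z) (fun z => mul_nonneg (inv_pos.2 hJ).le (hρ0 z).le)
    (by rw [integral_const_mul, ← hJdef]; exact inv_mul_cancel₀ hJ.ne') hdec hfi (x₀ := x)
    (hf.continuousOn.continuousAt (isOpen_compl_singleton.mem_nhds hx))
  have peak2 := peak.const_mul ((n * (2 - n)) * J)
  -- the other limit
  have lim : Tendsto (fun c : ℝ => ∫ y, g y * (‖y - x‖ ^ 2 + c⁻¹ ^ 2) ^ (((2 : ℝ) - n) / 2)) atTop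
      (𝓝 (∫ y, g y * ‖y - x‖ ^ ((2 : ℝ) - n))) := by
    have hsq : ∀ y : E n, ‖y - x‖ ^ ((2 : ℝ) - n) = (‖y - x‖ ^ 2) ^ (((2 : ℝ) - n) / 2) := by
      intro y
      rw [← Real.rpow_natCast, ← Real.rpow_mul (norm_nonneg _)]
      congr 1; push_cast; ring
    have hne : ∀ᵐ y : E n, y ≠ x := by simp [ae_iff]
    have hIntg : Integrable (fun y => g y * ‖y - x‖ ^ ((2 : ℝ) - n)) :=
      (norm_rpow_locInt' hn x).integrable_smul_left_of_hasCompactSupport hg hgc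
    refine tendsto_integral_filter_of_dominated_convergence
      (fun y => ‖g y * ‖y - x‖ ^ ((2 : ℝ) - n)‖) ?_ ?_ hIntg.norm ?_
    · filter_upwards [eventually_gt_atTop 0] with c hc
      exact (hg.mul (reg_contDiff x (inv_pos.2 hc) _).continuous).aestronglyMeasurable
    · filter_upwards [eventually_gt_atTop 0] with c hc
      filter_upwards [hne] with y hy
      have hpos : 0 < ‖y - x‖ := norm_pos_iff.2 (sub_ne_zero.2 hy)
      rw [norm_mul, norm_mul, hsq,
        Real.norm_of_nonneg (by positivity : 0 ≤ (‖y - x‖ ^ 2 + c⁻¹ ^ 2) ^ (((2 : ℝ) - n) / 2)),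
        Real.norm_of_nonneg (by positivity : 0 ≤ (‖y - x‖ ^ 2) ^ (((2 : ℝ) - n) / 2))]
      refine mul_le_mul_of_nonneg_left ?_ (norm_nonneg _)
      apply Real.rpow_le_rpow_of_nonpos (by positivity) _ (by linarith)
      have : 0 ≤ c⁻¹ ^ 2 := by positivity
      linarith
    · filter_upwards [hne] with y hy
      have hpos : 0 < ‖y - x‖ := norm_pos_iff.2 (sub_ne_zero.2 hy)
      rw [hsq]
      refine Tendsto.const_mul _ ?_
      refine Tendsto.rpow_const ?_ (Or.inl (by positivity))
      have : Tendsto (fun c : ℝ => ‖y - x‖ ^ 2 + c⁻¹ ^ 2) atTop (𝓝 (‖y - x‖ ^ 2 + 0 ^ 2)) :=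
        (tendsto_inv_atTop_zero.pow 2).const_add _
      simpa using this
  refine tendsto_nhds_unique peak2 (lim.congr' ?_)
  filter_upwards [eventually_gt_atTop 0] with c hc
  have hc' : 0 < c⁻¹ := inv_pos.2 hc
  rw [← weak hn hf hfc ho hg hgc hfg (reg_contDiff x hc' _), ← integral_const_mul]
  refine integral_congr_ae (Eventually.of_forall fun y => ?_)
  simp only [finrank_euclideanSpace, Fintype.card_fin, smul_eq_mul]
  rw [lap_reg x hc']
  have hkey : c⁻¹ ^ 2 * (‖y - x‖ ^ 2 + c⁻¹ ^ 2) ^ (-((n : ℝ) + 2) / 2)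
      = c ^ n * ρ (c • (x - y)) := by
    have h1 : ‖y - x‖ ^ 2 + c⁻¹ ^ 2 = (c ^ 2)⁻¹ * (1 + ‖c • (x - y)‖ ^ 2) := by
      rw [norm_smul, norm_sub_rev x y, Real.norm_of_nonneg hc.le]
      field_simp
      ring
    rw [h1, Real.mul_rpow (by positivity) (by positivity)]
    have h2 : ((c ^ 2)⁻¹) ^ (-((n : ℝ) + 2) / 2) = c ^ (n + 2) := by
      rw [Real.inv_rpow (by positivity), ← Real.rpow_neg (by positivity), ← Real.rpow_natCast c 2,
        ← Real.rpow_mul hc.le, ← Real.rpow_natCast]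
      congr 1; push_cast; ring
    rw [h2, pow_add]
    simp only [hρ]
    field_simp
  rw [hkey]
  field_simp

lemma update_ev {n : ℕ} (w : E n → ℝ) (x₀ : E n) (a : ℝ) {x : E n} (hx : x ≠ x₀) :
    Function.update w x₀ a =ᶠ[𝓝 x] w := by
  filter_upwards [isOpen_compl_singleton.mem_nhds hx] with y hy
  exact Function.update_of_ne hy _ _

lemma step {n : ℕ} (hn : 3 ≤ n) {x₀ : E n} {R : ℝ} (hR : 0 < R) {w h : E n → ℝ}
    (hw : ContDiffOn ℝ (⊤ : ℕ∞) w (ball x₀ R \ {x₀}))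
    (ho : w =o[𝓝[≠] x₀] fun x => ‖x - x₀‖ ^ ((2 : ℝ) - n))
    (hh : ContDiffOn ℝ (⊤ : ℕ∞) h (ball x₀ R))
    (hwh : ∀ x ∈ ball x₀ R \ {x₀}, lap w x = h x) :
    ∃ a, ContDiffOn ℝ (⊤ : ℕ∞) (Function.update w x₀ a) (ball x₀ R) := by
  have hop : IsOpen (ball x₀ R \ {x₀}) := isOpen_ball.sdiff isClosed_singleton
  let χ : ContDiffBump x₀ := ⟨R / 3, R / 2, by positivity, by linarith⟩
  let f : E n → ℝ := fun y => χ y * w y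
  have hfz : ∀ y, y ∉ closedBall x₀ (R / 2) → f =ᶠ[𝓝 y] fun _ => 0 := by
    intro y hy
    filter_upwards [isClosed_closedBall.isOpen_compl.mem_nhds hy] with z hz
    have : χ z = 0 := χ.zero_of_le_dist (by
      have : R / 2 < dist z x₀ := by simpa using hz
      exact this.le)
    simp [f, this]
  have hf1 : ∀ y ∈ ball x₀ (R / 3), f y = w y := by
    intro y hy
    have : χ y = 1 := χ.one_of_mem_closedBall (ball_subset_closedBall hy)
    simp [f, this]
  have hf : ContDiffOn ℝ (⊤ : ℕ∞) f {x₀}ᶜ := by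
    intro x hx
    refine ContDiffAt.contDiffWithinAt ?_
    by_cases hxR : x ∈ ball x₀ R
    · exact χ.contDiffAt.mul (hw.contDiffAt (hop.mem_nhds ⟨hxR, hx⟩))
    · refine contDiffAt_const.congr_of_eventuallyEq (hfz x ?_)
      intro h
      exact hxR (closedBall_subset_ball (by linarith) h)
  have hfc : HasCompactSupport f := χ.hasCompactSupport.mul_right
  have hfo : f =o[𝓝[≠] x₀] fun x => ‖x - x₀‖ ^ ((2 : ℝ) - n) := by
    refine IsBigO.trans_isLittleO (IsBigO.of_bound 1 (Eventually.of_forall fun y => ?_)) ho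
    simp only [f]
    rw [norm_mul, Real.norm_of_nonneg χ.nonneg]
    exact mul_le_mul_of_nonneg_right χ.le_one (norm_nonneg _)
  let g : E n → ℝ := Function.update (lap f) x₀ (h x₀)
  have hg : ContDiff ℝ (⊤ : ℕ∞) g := by
    rw [contDiff_iff_contDiffAt]
    intro x
    by_cases hx : x = x₀
    · subst hx
      refine (hh.contDiffAt (isOpen_ball.mem_nhds (mem_ball_self hR))).congr_of_eventuallyEq ?_
      filter_upwards [ball_mem_nhds x (show 0 < R / 3 by positivity)] with y hy
      by_cases hyx : y = x
      · subst hyx; simp [g]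
      · simp only [g]
        rw [Function.update_of_ne hyx, ← hwh y ⟨ball_subset_ball (by linarith) hy, hyx⟩]
        refine (lap_congr ?_).eq_of_nhds
        filter_upwards [isOpen_ball.mem_nhds hy] with z hz
        exact hf1 z hz
    · exact ((lap_contDiffOn isOpen_compl_singleton hf).contDiffAt
        (isOpen_compl_singleton.mem_nhds hx)).congr_of_eventuallyEq (update_ev _ _ _ hx)
  have hgc : HasCompactSupport g := by
    refine HasCompactSupport.intro (isCompact_closedBall x₀ (R / 2)) fun y hy => ?_
    have hyx : y ≠ x₀ := by
      rintro rfl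
      exact hy (mem_closedBall_self (by positivity))
    simp only [g]
    rw [Function.update_of_ne hyx, (lap_congr (hfz y hy)).eq_of_nhds]
    simp [lap]
  have hfg : ∀ x, x ≠ x₀ → lap f x = g x := fun x hx => by simp [g, Function.update_of_ne hx]
  obtain ⟨I, hI, hrep⟩ := repr_formula hn
  let G : E n → ℝ := fun x => I⁻¹ * ∫ y, g y * ‖y - x‖ ^ ((2 : ℝ) - n)
  have hG : ContDiff ℝ (⊤ : ℕ∞) G := by
    refine contDiff_const.mul ?_
    have h1 := hgc.contDiff_convolution_right (𝕜 := ℝ) (n := ⊤) (ContinuousLinearMap.mul ℝ ℝ)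
      (norm_rpow_locInt hn) hg
    refine (congrArg (ContDiff ℝ (⊤ : ℕ∞)) (funext fun x => ?_)).mpr h1
    rw [convolution_eq_swap]
    refine integral_congr_ae (Eventually.of_forall fun y => ?_)
    simp only [ContinuousLinearMap.mul_apply']
    rw [mul_comm, norm_sub_rev]
  refine ⟨G x₀, fun x hx => ContDiffAt.contDiffWithinAt ?_⟩
  by_cases hxx : x = x₀
  · subst hxx
    refine hG.contDiffAt.congr_of_eventuallyEq ?_
    filter_upwards [ball_mem_nhds x (show 0 < R / 3 by positivity)] with y hy
    by_cases hyx : y = x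
    · subst hyx; simp
    · rw [Function.update_of_ne hyx, ← hf1 y hy]
      simp only [G]
      rw [← hrep hf hfc hfo hg.continuous hgc hfg y hyx]
      field_simp
  · exact (hw.contDiffAt (hop.mem_nhds ⟨hx, hxx⟩)).congr_of_eventuallyEq (update_ev _ _ _ hxx)

/-- Theorem 1 (sufficiency, n ≥ 3): if `Δᵐu = 0` on `Ω \ {x₀}` and
`|Δᵏu(x)| = o(|x-x₀|^{2-n})` for all `k = 0,…,m-1`, then `u` has a removable
singularity at `x₀`. -/
theorem polyharmonic_removable_of_littleO (n m : ℕ) (hn : 3 ≤ n) (hm : 2 ≤ m)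
    (Ω : Set (E n)) (hΩ : IsOpen Ω) (hΩc : IsConnected Ω)
    (x₀ : E n) (hx₀ : x₀ ∈ Ω) (u : E n → ℝ)
    (hu : ContDiffOn ℝ (⊤ : ℕ∞) u (Ω \ {x₀}))
    (hpoly : ∀ x ∈ Ω \ {x₀}, lap^[m] u x = 0)
    (ho : ∀ k < m, (lap^[k] u) =o[𝓝[≠] x₀] fun x => ‖x - x₀‖ ^ ((2 : ℝ) - n)) :
    ∃ δ > 0, closedBall x₀ δ ⊆ Ω ∧
      ∃ v : E n → ℝ, ContDiffOn ℝ (⊤ : ℕ∞) v (ball x₀ δ) ∧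
        (∀ x ∈ ball x₀ δ, lap^[m] v x = 0) ∧
        ∀ x ∈ ball x₀ δ \ {x₀}, u x = v x := by

  obtain ⟨R, hR, hRΩ⟩ := Metric.nhds_basis_closedBall.mem_iff.1 (hΩ.mem_nhds hx₀)
  refine ⟨R, hR, hRΩ, ?_⟩
  have hop : IsOpen (ball x₀ R \ {x₀}) := isOpen_ball.sdiff isClosed_singleton
  have hsub : ball x₀ R \ {x₀} ⊆ Ω \ {x₀} :=
    Set.sdiff_subset_sdiff_left (ball_subset_closedBall.trans hRΩ)
  have hu' := hu.mono hsub
  have hall : ∀ j ≤ m, ∃ a, ContDiffOn ℝ (⊤ : ℕ∞)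
      (Function.update (lap^[m - j] u) x₀ a) (ball x₀ R) := by
    intro j
    induction j with
    | zero =>
      intro _
      refine ⟨0, contDiffOn_const.congr (f := fun _ => (0 : ℝ)) fun x hx => ?_⟩
      by_cases hxx : x = x₀
      · subst hxx; simp
      · rw [Function.update_of_ne hxx]
        exact hpoly x (hsub ⟨hx, hxx⟩)
    | succ j ih =>
      intro hj
      obtain ⟨a, ha⟩ := ih (by omega)
      refine step hn hR (lap_iter_contDiffOn hop hu' _) (ho _ (by omega)) ha fun x hx => ?_
      rw [Function.update_of_ne hx.2, ← Function.iterate_succ_apply' lap,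
        show (m - (j + 1)).succ = m - j by omega]
  obtain ⟨a, ha⟩ := hall m le_rfl
  rw [Nat.sub_self, Function.iterate_zero, id] at ha
  have hoff : ∀ x ∈ ball x₀ R \ {x₀}, lap^[m] (Function.update u x₀ a) x = 0 := fun x hx => by
    rw [(lap_iter_congr (update_ev u x₀ a hx.2) m).eq_of_nhds]
    exact hpoly x (hsub hx)
  refine ⟨Function.update u x₀ a, ha, fun x hx => ?_, fun x hx => ?_⟩
  · by_cases hxx : x = x₀
    · subst hxx
      have := nontriv hn
      have hc : ContinuousAt (lap^[m] (Function.update u x a)) x :=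
        (lap_iter_contDiffOn isOpen_ball ha m).continuousOn.continuousAt (isOpen_ball.mem_nhds hx)
      have hc2 : Tendsto (lap^[m] (Function.update u x a)) (𝓝[≠] x) (𝓝 0) := by
        refine tendsto_const_nhds.congr' ?_
        filter_upwards [self_mem_nhdsWithin, mem_nhdsWithin_of_mem_nhds (isOpen_ball.mem_nhds hx)]
          with y hy1 hy2
        exact (hoff y ⟨hy2, hy1⟩).symm
      have : (𝓝[≠] x).NeBot := Module.punctured_nhds_neBot ℝ (E n) x
      exact tendsto_nhds_unique (hc.tendsto.mono_left nhdsWithin_le_nhds) hc2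
    · exact hoff x ⟨hx, hxx⟩
  · exact (Function.update_of_ne hx.2 _ _).symm
end

section
/- Let n = 2, m ≥ 2, and let u be a smooth solution of Δᵐu = 0 in Ω\{x₀} ⊂ ℝ². If |Δᵏu(x)| = o(log(1/|x - x₀|)) as |x - x₀| → 0 for every k = 0, 1, ..., m-1, then u has a removable singularity at x₀. -/
open Metric Filter MeasureTheory Asymptotics
open scoped Topology

/-- The real-linear functional `v ↦ Re (a v)`. -/
noncomputable def reMul (a : ℂ) : ℂ →L[ℝ] ℝ :=
  Complex.reCLM.comp ((a • (1 : ℂ →L[ℂ] ℂ)).restrictScalars ℝ)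

lemma reMul_apply (a v : ℂ) : reMul a v = (a * v).re := by
  simp [reMul]

lemma reMul_inj {a b : ℂ} (h : reMul a = reMul b) : a = b := by
  have h1 := congrArg (fun T : ℂ →L[ℝ] ℝ => T 1) h
  have h2 := congrArg (fun T : ℂ →L[ℝ] ℝ => T Complex.I) h
  simp only [reMul_apply] at h1 h2
  apply Complex.ext
  · simpa using h1
  · simpa using h2

lemma hasFDerivAt_re {F : ℂ → ℂ} {a z : ℂ} (h : HasDerivAt F a z) :
    HasFDerivAt (fun z => (F z).re) (reMul a) z := by
  have h1 := (h.hasFDerivAt.restrictScalars ℝ)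
  have h2 := (Complex.reCLM.hasFDerivAt (x := F z)).comp z h1
  refine h2.congr_fderiv ?_
  ext v
  simp [reMul_apply, mul_comm]

lemma hasFDerivAt_partial {U : ℂ → ℝ} {z : ℂ} (h : DifferentiableAt ℝ U z) :
    HasFDerivAt U (reMul (fderiv ℝ U z 1 - Complex.I * fderiv ℝ U z Complex.I)) z := by
  refine h.hasFDerivAt.congr_fderiv ?_
  ext v
  rw [reMul_apply]
  nth_rw 1 [(by simp : v = v.re • (1 : ℂ) + v.im • (Complex.I : ℂ))]
  rw [map_add, map_smul, map_smul]
  simp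
  ring

lemma hasFDerivAt_comp_exp {U : ℂ → ℝ} {b ζ : ℂ} (h : HasFDerivAt U (reMul b) (Complex.exp ζ)) :
    HasFDerivAt (fun ζ => U (Complex.exp ζ)) (reMul (b * Complex.exp ζ)) ζ := by
  have h1 := ((Complex.hasDerivAt_exp ζ).hasFDerivAt.restrictScalars ℝ)
  have h2 := h.comp ζ h1
  refine h2.congr_fderiv ?_
  ext v
  simp only [ContinuousLinearMap.comp_apply, reMul_apply]
  simp [mul_comm, mul_left_comm]

open InnerProductSpace in
/-- Gradient estimate for harmonic functions. -/
lemma grad_est {U : ℂ → ℝ} {z : ℂ} {r M : ℝ} (hr : 0 < r) (hM : 0 < M)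
    (hU : HarmonicOnNhd U (ball z r)) (hb : ∀ w ∈ ball z r, |U w| ≤ M) :
    ‖(fderiv ℝ U z 1 - Complex.I * fderiv ℝ U z Complex.I : ℂ)‖ ≤ 8 * M / r := by
  obtain ⟨F, hF, hFU⟩ := hU.exists_analyticOnNhd_ball_re_eq
  have hz : z ∈ ball z r := mem_ball_self hr
  have hd : HasDerivAt F (deriv F z) z := (hF z hz).differentiableAt.hasDerivAt
  have h1 : HasFDerivAt U (reMul (deriv F z)) z :=
    (hasFDerivAt_re hd).congr_of_eventuallyEq
      ((hFU.eventuallyEq_of_mem (ball_mem_nhds z hr)).symm)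
  have h2 := hasFDerivAt_partial h1.differentiableAt
  rw [reMul_inj (h2.unique h1)]
  set G : ℂ → ℂ := fun w => F (z + w) - F z with hG
  have hmem : ∀ w ∈ ball (0 : ℂ) r, z + w ∈ ball z r := by
    intro w hw
    simpa using hw
  have hGd : DifferentiableOn ℂ G (ball 0 r) := by
    intro w hw
    have := (hF _ (hmem w hw)).differentiableAt
    exact ((this.comp w (by fun_prop : DifferentiableAt ℂ (fun w => z + w) w)).sub_const
      _).differentiableWithinAt
  have hGm : Set.MapsTo G (ball 0 r) {w | w.re ≤ 2 * M} := by
    intro w hw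
    have a1 := hFU (hmem w hw)
    have a2 := hFU hz
    have a3 := abs_le.1 (hb _ (hmem w hw))
    have a4 := abs_le.1 (hb _ hz)
    simp only [] at a1 a2
    change (G w).re ≤ 2 * M
    simp only [hG, Complex.sub_re]
    linarith
  have hG0 : G 0 = 0 := by simp [hG]
  have key : ∀ w ∈ ball (0 : ℂ) (r / 2), ‖G w‖ ≤ 8 * M / r * ‖w‖ := by
    intro w hw
    have hw' : ‖w‖ < r / 2 := by simpa using hw
    have := Complex.borelCaratheodory_zero (by positivity : 0 < 2 * M) hGd hGm hr
      (z := w) (by simp; linarith) hG0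
    refine this.trans ?_
    rw [div_le_iff₀ (by linarith), div_mul_eq_mul_div, div_mul_eq_mul_div, le_div_iff₀ hr]
    nlinarith [mul_nonneg (mul_nonneg hM.le (norm_nonneg w)) (by linarith : 0 ≤ r / 2 - ‖w‖)]
  have hGder : HasDerivAt G (deriv F z) 0 := by
    have : HasDerivAt F (deriv F z) (z + 0) := by simpa using hd
    exact (this.comp_const_add z 0).sub_const _
  have := hGder.le_of_lip' (C := 8 * M / r) (by positivity) (by
    filter_upwards [ball_mem_nhds (0 : ℂ) (half_pos hr)] with w hw
    simpa [hG0] using key w hw)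
  exact this

open InnerProductSpace in
lemma harm_removable {U : ℂ → ℝ} {R : ℝ} (hR : 0 < R)
    (hU : HarmonicOnNhd U (ball 0 R \ {0}))
    (ho : U =o[𝓝[≠] 0] fun z => Real.log ‖z‖) :
    ∃ H : ℂ → ℂ, DifferentiableOn ℂ H (ball 0 R) ∧ ∀ z ∈ ball 0 R \ {0}, U z = (H z).re := by
  set f : ℂ → ℂ := fun z => fderiv ℝ U z 1 - Complex.I * fderiv ℝ U z Complex.I with hf
  have hfd : DifferentiableOn ℂ f (ball 0 R \ {0}) := fun z hz =>
    (HarmonicAt.differentiableAt_complex_partial (hU z hz)).differentiableWithinAt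
  have hUf : ∀ z ∈ ball 0 R \ {0}, HasFDerivAt U (reMul (f z)) z := fun z hz =>
    hasFDerivAt_partial ((hU z hz).1.differentiableAt two_ne_zero)
  -- `U = o(1/|z|)`
  have hlog : (fun z : ℂ => Real.log ‖z‖) =o[𝓝[≠] 0] fun z => ‖z‖⁻¹ := by
    have h1 : Tendsto (fun z : ℂ => ‖z‖) (𝓝[≠] 0) (𝓝[>] 0) := tendsto_norm_nhdsNE_zero
    have h2 := isLittleO_log_rpow_nhdsGT_zero (r := -1) (by norm_num)
    have h3 := h2.comp_tendsto h1
    refine h3.congr_right ?_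
    intro z
    simp [Real.rpow_neg_one]
  have hU1 := ho.trans hlog
  have hg : (fun z => (z * f z) - (0 * f 0)) =o[𝓝[≠] 0] fun z : ℂ => (z - 0)⁻¹ := by
    simp only [zero_mul, sub_zero]
    rw [isLittleO_iff]
    intro ε hε
    have h1 := isLittleO_iff.1 hU1 (show 0 < ε / 32 by positivity)
    rw [eventually_nhdsWithin_iff, Metric.eventually_nhds_iff] at h1
    obtain ⟨δ, hδ, h1⟩ := h1
    rw [eventually_nhdsWithin_iff, Metric.eventually_nhds_iff]
    refine ⟨min δ R / 2, by positivity, ?_⟩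
    intro z hz hz0
    have hz0' : 0 < ‖z‖ := norm_pos_iff.2 hz0
    rw [dist_zero_right] at hz
    have e1 := min_le_left δ R
    have e2 := min_le_right δ R
    have hsub : ∀ w ∈ ball z (‖z‖ / 2), ‖z‖ / 2 < ‖w‖ ∧ ‖w‖ < min δ R := by
      intro w hw
      rw [mem_ball, dist_eq_norm] at hw
      constructor
      · have := norm_sub_norm_le z w
        rw [norm_sub_rev] at this
        linarith
      · have := norm_sub_norm_le w z
        linarith
    have hharm : HarmonicOnNhd U (ball z (‖z‖ / 2)) := hU.mono (fun w hw => by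
      obtain ⟨a, b⟩ := hsub w hw
      refine ⟨by simpa using b.trans_le e2, ?_⟩
      intro h
      rw [Set.mem_singleton_iff.1 h] at a
      simp at a
      linarith)
    have hbd : ∀ w ∈ ball z (‖z‖ / 2), |U w| ≤ ε / 16 / ‖z‖ := by
      intro w hw
      obtain ⟨a, b⟩ := hsub w hw
      have hw0 : 0 < ‖w‖ := by linarith
      have := h1 (y := w) (by simpa using b.trans_le e1) (norm_pos_iff.1 hw0)
      rw [Real.norm_eq_abs] at this
      refine this.trans ?_
      rw [norm_inv, norm_norm, ← div_eq_mul_inv, div_le_div_iff₀ hw0 hz0']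
      nlinarith
    have := grad_est (by positivity) (by positivity) hharm hbd
    rw [norm_mul, norm_inv]
    calc ‖z‖ * ‖f z‖ ≤ ‖z‖ * (8 * (ε / 16 / ‖z‖) / (‖z‖ / 2)) := by gcongr
      _ = ε * ‖z‖⁻¹ := by field_simp; ring
  have hgd : DifferentiableOn ℂ (fun z => z * f z) (ball 0 R \ {0}) := by fun_prop
  have hball : ball (0 : ℂ) R ∈ 𝓝 0 := ball_mem_nhds _ hR
  have hg2 := Complex.differentiableOn_update_limUnder_of_isLittleO hball hgd hg
  set g := Function.update (fun z => z * f z) 0 (limUnder (𝓝[≠] 0) fun z => z * f z) with hgdef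
  have hgz : ∀ z ≠ 0, g z = z * f z := fun z hz => by simp [hgdef, hz]
  have hh := (Complex.differentiableOn_dslope hball).2 hg2
  set h := dslope g 0 with hhdef
  have hfz : ∀ z ≠ 0, z * f z = g 0 + z * h z := by
    intro z hz
    rw [hhdef, dslope_of_ne _ hz, slope_def_field, ← hgz z hz]
    simp only [sub_zero]
    field_simp
    ring
  set c := g 0 with hc
  obtain ⟨H, hH⟩ := hh.isExactOn_ball
  set S : Set ℂ := {ζ | ζ.re < Real.log R} with hS
  have hSmem : ∀ ζ ∈ S, Complex.exp ζ ∈ ball 0 R \ {0} := by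
    intro ζ hζ
    refine ⟨?_, Complex.exp_ne_zero ζ⟩
    rw [mem_ball_zero_iff, Complex.norm_exp]
    exact (Real.lt_log_iff_exp_lt hR).1 hζ
  have hSo : IsOpen S := isOpen_lt Complex.continuous_re continuous_const
  have hSc : IsPreconnected S := (convex_halfSpace_re_lt _).isPreconnected
  have hQ : ∀ ζ ∈ S, HasFDerivAt
      (fun ζ => U (Complex.exp ζ) - (H (Complex.exp ζ) + c * ζ).re) (0 : ℂ →L[ℝ] ℝ) ζ := by
    intro ζ hζ
    have a1 := hasFDerivAt_comp_exp (hUf _ (hSmem ζ hζ))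
    have a2 : HasDerivAt (fun ζ => H (Complex.exp ζ) + c * ζ)
        (h (Complex.exp ζ) * Complex.exp ζ + c * 1) ζ :=
      ((hH _ (hSmem ζ hζ).1).comp ζ (Complex.hasDerivAt_exp ζ)).add
        ((hasDerivAt_id ζ).const_mul c)
    refine (a1.sub (hasFDerivAt_re a2)).congr_fderiv ?_
    have : f (Complex.exp ζ) * Complex.exp ζ = h (Complex.exp ζ) * Complex.exp ζ + c * 1 := by
      rw [mul_comm, hfz _ (Complex.exp_ne_zero ζ)]
      ring
    rw [this, sub_self]
  set ζ₀ : ℂ := ((Real.log R - 1 : ℝ) : ℂ) with hζ₀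
  have hζ₀S : ζ₀ ∈ S := by simp [hS, hζ₀]
  have hconst : ∀ ζ ∈ S, U (Complex.exp ζ) - (H (Complex.exp ζ) + c * ζ).re =
      U (Complex.exp ζ₀) - (H (Complex.exp ζ₀) + c * ζ₀).re := by
    intro ζ hζ
    refine hSo.is_const_of_fderiv_eq_zero (𝕜 := ℝ) (f := fun ζ => U (Complex.exp ζ) - (H (Complex.exp ζ) + c * ζ).re) hSc
      (fun x hx => (hQ x hx).differentiableAt.differentiableWithinAt)
      (fun x hx => (hQ x hx).fderiv) hζ hζ₀S
  set K := U (Complex.exp ζ₀) - (H (Complex.exp ζ₀) + c * ζ₀).re with hK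
  have him : c.im = 0 := by
    have a1 := hconst (ζ₀ + 2 * Real.pi * Complex.I) (by simp [hS, hζ₀])
    rw [Complex.exp_periodic ζ₀, hK] at a1
    simp only [Complex.add_re, mul_add] at a1
    have : (c * (2 * Real.pi * Complex.I)).re = 0 := by linarith
    simp at this
    exact this
  have hre : c.re = 0 := by
    have t1 : Tendsto (fun t : ℝ => Complex.exp t) atBot (𝓝[≠] 0) := by
      rw [tendsto_nhdsWithin_iff]
      refine ⟨?_, Eventually.of_forall fun t => Complex.exp_ne_zero _⟩
      rw [tendsto_zero_iff_norm_tendsto_zero]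
      simp only [Complex.norm_exp, Complex.ofReal_re]
      exact Real.tendsto_exp_atBot
    have b1 : (fun t : ℝ => U (Complex.exp t)) =o[atBot] fun t : ℝ => t := by
      refine (ho.comp_tendsto t1).congr_right ?_
      intro t
      simp [Complex.norm_exp]
    have hHc : ContinuousAt H 0 := (hH 0 (mem_ball_self hR)).continuousAt
    have b2 : Tendsto (fun t : ℝ => (H (Complex.exp t)).re + K) atBot (𝓝 ((H 0).re + K)) :=
      (Complex.continuous_re.tendsto _).comp
        (hHc.tendsto.comp (t1.mono_right nhdsWithin_le_nhds)) |>.add_const K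
    have b3 : (fun t : ℝ => (H (Complex.exp t)).re + K) =o[atBot] fun t : ℝ => t := by
      refine (b2.isBigO_one ℝ).trans_isLittleO ?_
      rw [isLittleO_one_left_iff]
      exact tendsto_abs_atBot_atTop
    have b4 : (fun t : ℝ => c.re * t) =o[atBot] fun t : ℝ => t := by
      refine (b1.sub b3).congr' ?_ EventuallyEq.rfl
      filter_upwards [eventually_lt_atBot (Real.log R)] with t ht
      have := hconst (t : ℂ) (by simpa [hS] using ht)
      simp only [Complex.add_re, Complex.re_mul_ofReal] at this
      linarith
    by_contra hne
    have b5 := (isLittleO_const_mul_left_iff hne).1 b4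
    have b6 : ∀ᶠ t : ℝ in atBot, t ≠ 0 := (eventually_lt_atBot 0).mono fun t ht => ht.ne
    exact isLittleO_irrefl b6.frequently b5
  have hc0 : c = 0 := Complex.ext hre him
  refine ⟨fun z => H z + K, fun z hz => ((hH z hz).differentiableAt.add_const _).differentiableWithinAt, ?_⟩
  intro z hz
  have hz0 : z ≠ 0 := hz.2
  have hzS : Complex.log z ∈ S := by
    have : ‖z‖ < R := by simpa using hz.1
    simpa [hS, Complex.log_re] using Real.log_lt_log (norm_pos_iff.2 hz0) this
  have := hconst _ hzS
  rw [Complex.exp_log hz0, hc0] at this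
  simp at this ⊢
  linarith

lemma lap_congr_on {n : ℕ} {s : Set (E n)} (hs : IsOpen s) {f g : E n → ℝ} (h : Set.EqOn f g s) :
    Set.EqOn (lap f) (lap g) s := by
  intro x hx
  have h1 : ∀ y ∈ s, f =ᶠ[𝓝 y] g := fun y hy => h.eventuallyEq_of_mem (hs.mem_nhds hy)
  unfold lap
  refine Finset.sum_congr rfl fun i _ => ?_
  have : (fun y => fderiv ℝ f y (EuclideanSpace.single i 1)) =ᶠ[𝓝 x]
      (fun y => fderiv ℝ g y (EuclideanSpace.single i 1)) := by
    filter_upwards [hs.mem_nhds hx] with y hy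
    rw [(h1 y hy).fderiv_eq]
  rw [this.fderiv_eq]

lemma lap_iter_congr_on {n : ℕ} {s : Set (E n)} (hs : IsOpen s) (k : ℕ) {f g : E n → ℝ}
    (h : Set.EqOn f g s) : Set.EqOn (lap^[k] f) (lap^[k] g) s := by
  induction k with
  | zero => exact h
  | succ k ih =>
    rw [Function.iterate_succ_apply', Function.iterate_succ_apply']
    exact lap_congr_on hs ih

lemma contDiffOn_dir {n : ℕ} {s : Set (E n)} (hs : IsOpen s) {f : E n → ℝ}
    (h : ContDiffOn ℝ (⊤ : ℕ∞) f s) (v : E n) :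
    ContDiffOn ℝ (⊤ : ℕ∞) (fun y => fderiv ℝ f y v) s :=
  (h.fderiv_of_isOpen hs (by norm_cast)).clm_apply contDiffOn_const

lemma diffAt_of_smooth {n : ℕ} {s : Set (E n)} (hs : IsOpen s) {f : E n → ℝ}
    (h : ContDiffOn ℝ (⊤ : ℕ∞) f s) {x : E n} (hx : x ∈ s) : DifferentiableAt ℝ f x :=
  (h.contDiffAt (hs.mem_nhds hx)).differentiableAt (by simp)

lemma contDiffOn_lap {n : ℕ} {s : Set (E n)} (hs : IsOpen s) {f : E n → ℝ}
    (h : ContDiffOn ℝ (⊤ : ℕ∞) f s) : ContDiffOn ℝ (⊤ : ℕ∞) (lap f) s := by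
  unfold lap
  exact ContDiffOn.sum fun i _ => contDiffOn_dir hs (contDiffOn_dir hs h _) _

lemma contDiffOn_lap_iter {n : ℕ} {s : Set (E n)} (hs : IsOpen s) (k : ℕ) {f : E n → ℝ}
    (h : ContDiffOn ℝ (⊤ : ℕ∞) f s) : ContDiffOn ℝ (⊤ : ℕ∞) (lap^[k] f) s := by
  induction k with
  | zero => exact h
  | succ k ih =>
    rw [Function.iterate_succ_apply']
    exact contDiffOn_lap hs ih

lemma lap_sub_on {n : ℕ} {s : Set (E n)} (hs : IsOpen s) {f g : E n → ℝ}
    (hf : ContDiffOn ℝ (⊤ : ℕ∞) f s) (hg : ContDiffOn ℝ (⊤ : ℕ∞) g s) :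
    Set.EqOn (lap (fun x => f x - g x)) (fun x => lap f x - lap g x) s := by
  intro x hx
  simp only [lap]
  rw [← Finset.sum_sub_distrib]
  refine Finset.sum_congr rfl fun i _ => ?_
  have : (fun y => fderiv ℝ (fun x => f x - g x) y (EuclideanSpace.single i 1)) =ᶠ[𝓝 x]
      (fun y => fderiv ℝ f y (EuclideanSpace.single i 1) -
        fderiv ℝ g y (EuclideanSpace.single i 1)) := by
    filter_upwards [hs.mem_nhds hx] with y hy
    rw [fderiv_fun_sub (diffAt_of_smooth hs hf hy) (diffAt_of_smooth hs hg hy)]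
    rfl
  rw [this.fderiv_eq, fderiv_fun_sub (diffAt_of_smooth hs (contDiffOn_dir hs hf _) hx)
    (diffAt_of_smooth hs (contDiffOn_dir hs hg _) hx)]
  rfl

lemma lap_iter_sub_on {n : ℕ} {s : Set (E n)} (hs : IsOpen s) (k : ℕ) {f g : E n → ℝ}
    (hf : ContDiffOn ℝ (⊤ : ℕ∞) f s) (hg : ContDiffOn ℝ (⊤ : ℕ∞) g s) :
    Set.EqOn (lap^[k] (fun x => f x - g x)) (fun x => lap^[k] f x - lap^[k] g x) s := by
  induction k with
  | zero => intro x _; rfl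
  | succ k ih =>
    simp only [Function.iterate_succ_apply']
    exact (lap_congr_on hs ih).trans
      (lap_sub_on hs (contDiffOn_lap_iter hs k hf) (contDiffOn_lap_iter hs k hg))

lemma lap_zero_on {n : ℕ} {s : Set (E n)} (hs : IsOpen s) {f : E n → ℝ}
    (h : ∀ x ∈ s, f x = 0) : ∀ x ∈ s, lap f x = 0 := by
  intro x hx
  have h1 : Set.EqOn f (fun _ => (0 : ℝ)) s := h
  rw [lap_congr_on hs h1 hx]
  simp [lap]

/-- Complex coordinate on the plane. -/
noncomputable def toC : E 2 ≃ₗᵢ[ℝ] ℂ := Complex.orthonormalBasisOneI.repr.symm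

lemma toC_single0 : toC (EuclideanSpace.single 0 1) = 1 := by
  simp [toC]

lemma toC_single1 : toC (EuclideanSpace.single 1 1) = Complex.I := by
  simp [toC]

lemma toC_symm_one : toC.symm 1 = EuclideanSpace.single 0 1 := by
  rw [← toC_single0, LinearIsometryEquiv.symm_apply_apply]

lemma toC_symm_I : toC.symm Complex.I = EuclideanSpace.single 1 1 := by
  rw [← toC_single1, LinearIsometryEquiv.symm_apply_apply]

lemma toC_mem {x₀ x : E 2} {R : ℝ} (hx : x ∈ ball x₀ R) : toC (x - x₀) ∈ ball (0 : ℂ) R := by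
  rw [mem_ball_zero_iff, LinearIsometryEquiv.norm_map]
  simpa [dist_eq_norm] using hx

/-- `conj(z)^j G(z)` in the complex coordinate centred at `x₀`. -/
noncomputable def almC (x₀ : E 2) (j : ℕ) (G : ℂ → ℂ) (x : E 2) : ℂ :=
  (starRingEnd ℂ (toC (x - x₀))) ^ j * G (toC (x - x₀))

lemma almC_hasFDerivAt {x₀ x : E 2} (j : ℕ) {G : ℂ → ℂ}
    (hG : DifferentiableAt ℂ G (toC (x - x₀))) :
    ∃ L : E 2 →L[ℝ] ℂ, HasFDerivAt (almC x₀ j G) L x ∧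
      ∀ v, L v = (starRingEnd ℂ (toC v)) * (j * almC x₀ (j - 1) G x) +
        toC v * almC x₀ j (deriv G) x := by
  have hT : HasFDerivAt (fun x : E 2 => toC (x - x₀))
      (toC.toContinuousLinearEquiv : E 2 →L[ℝ] ℂ) x := by
    have h := ((toC.toContinuousLinearEquiv : E 2 →L[ℝ] ℂ).hasFDerivAt (x := x)).sub_const (toC x₀)
    refine h.congr_of_eventuallyEq (Eventually.of_forall fun y => ?_)
    exact map_sub toC y x₀
  have h1 := ((Complex.conjCLE : ℂ →L[ℝ] ℂ).hasFDerivAt (x := toC (x - x₀))).comp x hT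
  have h2 := h1.pow j
  have h3 := (hG.hasDerivAt.hasFDerivAt.restrictScalars ℝ).comp x hT
  have h4 := h2.mul h3
  refine ⟨_, h4, ?_⟩
  intro v
  simp [almC]
  ring

lemma almC_lap {x₀ : E 2} {R : ℝ} (j : ℕ) {G : ℂ → ℂ} (hG : DifferentiableOn ℂ G (ball 0 R)) :
    ∀ x ∈ ball x₀ R, lap (fun y => (almC x₀ j G y).re) x =
      (4 * j * almC x₀ (j - 1) (deriv G) x).re := by
  intro x hx
  have hd : ∀ y ∈ ball x₀ R, DifferentiableAt ℂ G (toC (y - x₀)) := fun y hy =>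
    hG.differentiableAt (isOpen_ball.mem_nhds (toC_mem hy))
  have hd' : ∀ y ∈ ball x₀ R, DifferentiableAt ℂ (deriv G) (toC (y - x₀)) := fun y hy =>
    (hG.deriv isOpen_ball).differentiableAt (isOpen_ball.mem_nhds (toC_mem hy))
  have key : ∀ v : E 2, fderiv ℝ (fun y => fderiv ℝ (fun y => (almC x₀ j G y).re) y v) x v =
      (starRingEnd ℂ (toC v) * (j * (starRingEnd ℂ (toC v) *
        ((j - 1 : ℕ) * almC x₀ (j - 1 - 1) G x) + toC v * almC x₀ (j - 1) (deriv G) x)) +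
       toC v * (starRingEnd ℂ (toC v) * (j * almC x₀ (j - 1) (deriv G) x) +
        toC v * almC x₀ j (deriv (deriv G)) x)).re := by
    intro v
    have e1 : (fun y => fderiv ℝ (fun y => (almC x₀ j G y).re) y v) =ᶠ[𝓝 x]
        fun y => ((starRingEnd ℂ (toC v)) * (j * almC x₀ (j - 1) G y) +
        toC v * almC x₀ j (deriv G) y).re := by
      filter_upwards [isOpen_ball.mem_nhds hx] with y hy
      obtain ⟨L, hL, hLv⟩ := almC_hasFDerivAt (x₀ := x₀) j (hd y hy)
      have := (Complex.reCLM.hasFDerivAt (x := almC x₀ j G y)).comp y hL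
      rw [← hLv v]
      exact congrArg (fun T : E 2 →L[ℝ] ℝ => T v) this.fderiv
    rw [e1.fderiv_eq]
    obtain ⟨L1, hL1, hLv1⟩ := almC_hasFDerivAt (x₀ := x₀) (j - 1) (hd x hx)
    obtain ⟨L2, hL2, hLv2⟩ := almC_hasFDerivAt (x₀ := x₀) j (hd' x hx)
    have h5 := ((hL1.const_mul (j : ℂ)).const_mul (starRingEnd ℂ (toC v))).add
      (hL2.const_mul (toC v))
    have := (Complex.reCLM.hasFDerivAt (x := _)).comp x h5
    refine (congrArg (fun T : E 2 →L[ℝ] ℝ => T v) this.fderiv).trans ?_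
    rw [← hLv1 v, ← hLv2 v]
    simp
  unfold lap
  rw [Fin.sum_univ_two, key, key, toC_single0, toC_single1, ← Complex.add_re]
  congr 1
  simp only [map_one, Complex.conj_I]
  linear_combination (j * ((j - 1 : ℕ) * almC x₀ (j - 1 - 1) G x) -
    2 * j * almC x₀ (j - 1) (deriv G) x + almC x₀ j (deriv (deriv G)) x) * Complex.I_sq

lemma almC_smooth {x₀ : E 2} {R : ℝ} (j : ℕ) {G : ℂ → ℂ}
    (hG : DifferentiableOn ℂ G (ball 0 R)) :
    ContDiffOn ℝ (⊤ : ℕ∞) (fun y => (almC x₀ j G y).re) (ball x₀ R) := by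
  have hT : ContDiff ℝ (⊤ : ℕ∞) (fun x : E 2 => toC (x - x₀)) :=
    toC.contDiff.comp (contDiff_id.sub contDiff_const)
  have h1 : ContDiffOn ℝ (⊤ : ℕ∞) (fun y => G (toC (y - x₀))) (ball x₀ R) :=
    ((hG.contDiffOn isOpen_ball).restrict_scalars ℝ).comp hT.contDiffOn (fun x hx => toC_mem hx)
  have h2 : ContDiff ℝ (⊤ : ℕ∞) (fun y : E 2 => starRingEnd ℂ (toC (y - x₀)) ^ j) :=
    (Complex.conjCLE.contDiff.comp hT).pow j
  exact Complex.reCLM.contDiff.comp_contDiffOn (h2.contDiffOn.mul h1)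

lemma exists_lap_iter {x₀ : E 2} {R : ℝ} (j : ℕ) : ∀ {F : ℂ → ℂ},
    DifferentiableOn ℂ F (ball 0 R) → ∃ G : ℂ → ℂ, DifferentiableOn ℂ G (ball 0 R) ∧
      ∀ x ∈ ball x₀ R, lap^[j] (fun y => (almC x₀ j G y).re) x = (F (toC (x - x₀))).re := by
  induction j with
  | zero =>
    intro F hF
    exact ⟨F, hF, fun x hx => by simp [almC]⟩
  | succ j ih =>
    intro F hF
    obtain ⟨G₀, hG₀, h⟩ := ih hF
    have h1 : DifferentiableOn ℂ (fun z => (4 * ((j : ℂ) + 1))⁻¹ * G₀ z) (ball 0 R) :=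
      hG₀.const_mul _
    obtain ⟨G, hG⟩ := h1.isExactOn_ball
    have hGd : DifferentiableOn ℂ G (ball 0 R) :=
      fun z hz => (hG z hz).differentiableAt.differentiableWithinAt
    refine ⟨G, hGd, fun x hx => ?_⟩
    rw [Function.iterate_succ_apply, ← h x hx]
    refine lap_iter_congr_on isOpen_ball j ?_ hx
    intro y hy
    rw [almC_lap (j + 1) hGd y hy]
    simp only [almC, (hG _ (toC_mem hy)).deriv, Nat.add_sub_cancel]
    congr 1
    have : (j : ℂ) + 1 ≠ 0 := by exact_mod_cast Nat.succ_ne_zero j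
    push_cast
    field_simp

open InnerProductSpace in
lemma harm_transfer {x₀ : E 2} {s : Set (E 2)} (hs : IsOpen s) {h : E 2 → ℝ}
    (hh : ContDiffOn ℝ (⊤ : ℕ∞) h s) (hl : ∀ x ∈ s, lap h x = 0) :
    HarmonicOnNhd (fun z : ℂ => h (x₀ + toC.symm z)) {z | x₀ + toC.symm z ∈ s} := by
  have hT : ContDiff ℝ (⊤ : ℕ∞) (fun z : ℂ => x₀ + toC.symm z) :=
    contDiff_const.add toC.symm.contDiff
  have hTd : ∀ z, HasFDerivAt (fun z : ℂ => x₀ + toC.symm z)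
      (toC.symm.toContinuousLinearEquiv : ℂ →L[ℝ] E 2) z := fun z =>
    ((toC.symm.toContinuousLinearEquiv : ℂ →L[ℝ] E 2).hasFDerivAt (x := z)).const_add x₀
  set s' : Set ℂ := {z | x₀ + toC.symm z ∈ s} with hs'
  have hsOpen : IsOpen s' := hs.preimage hT.continuous
  set U : ℂ → ℝ := fun z : ℂ => h (x₀ + toC.symm z) with hU
  have hUs : ContDiffOn ℝ (⊤ : ℕ∞) U s' := hh.comp hT.contDiffOn (fun z hz => hz)
  have dir : ∀ (k : E 2 → ℝ), ContDiffOn ℝ (⊤ : ℕ∞) k s → ∀ z ∈ s', ∀ v,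
      fderiv ℝ (fun z => k (x₀ + toC.symm z)) z v = fderiv ℝ k (x₀ + toC.symm z) (toC.symm v) := by
    intro k hk z hz v
    have := (diffAt_of_smooth hs hk hz).hasFDerivAt.comp z (hTd z)
    exact congrArg (fun T : ℂ →L[ℝ] ℝ => T v) this.fderiv
  have snd : ∀ z ∈ s', ∀ v, iteratedFDeriv ℝ 2 U z ![v, v] =
      fderiv ℝ (fun y => fderiv ℝ h y (toC.symm v)) (x₀ + toC.symm z) (toC.symm v) := by
    intro z hz v
    rw [iteratedFDeriv_two_apply, ← dir _ (contDiffOn_dir hs hh (toC.symm v)) z hz v]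
    have e : (fun z => fderiv ℝ h (x₀ + toC.symm z) (toC.symm v)) =ᶠ[𝓝 z]
        (fun z => fderiv ℝ U z v) := by
      filter_upwards [hsOpen.mem_nhds hz] with y hy
      exact (dir h hh y hy v).symm
    rw [e.fderiv_eq]
    have hd : DifferentiableAt ℝ (fderiv ℝ U) z :=
      ((hUs.fderiv_of_isOpen (m := (⊤ : ℕ∞)) hsOpen (by norm_cast)).contDiffAt
        (hsOpen.mem_nhds hz)).differentiableAt (by simp)
    rw [fderiv_clm_apply hd (differentiableAt_const v)]
    simp
  intro z hz
  refine ⟨(hUs.contDiffAt (hsOpen.mem_nhds hz)).of_le (by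
    exact WithTop.coe_le_coe.2 (le_top : (2 : ℕ∞) ≤ ⊤)), ?_⟩
  filter_upwards [hsOpen.mem_nhds hz] with y hy
  rw [laplacian_eq_iteratedFDeriv_complexPlane]
  simp only [snd y hy, toC_symm_one, toC_symm_I]
  have := hl _ hy
  rw [lap, Fin.sum_univ_two] at this
  simpa using this

lemma bdd_littleO {x₀ : E 2} {f : E 2 → ℝ} (hf : ContinuousAt f x₀) :
    f =o[𝓝[≠] x₀] fun x => Real.log (1 / ‖x - x₀‖) := by
  refine ((hf.tendsto.mono_left nhdsWithin_le_nhds).isBigO_one ℝ).trans_isLittleO ?_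
  rw [isLittleO_one_left_iff]
  have h1 : Tendsto (fun x : E 2 => ‖x - x₀‖) (𝓝[≠] x₀) (𝓝[>] 0) := by
    rw [tendsto_nhdsWithin_iff]
    constructor
    · have : ContinuousAt (fun x : E 2 => ‖x - x₀‖) x₀ := by fun_prop
      have h := this.tendsto
      simp only [sub_self, norm_zero] at h
      exact h.mono_left nhdsWithin_le_nhds
    · filter_upwards [self_mem_nhdsWithin] with x hx
      exact norm_pos_iff.2 (sub_ne_zero.2 hx)
  have h2 := Real.tendsto_log_atTop.comp (tendsto_inv_nhdsGT_zero.comp h1)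
  simp only [one_div]
  exact tendsto_norm_atTop_atTop.comp h2

lemma harm_E2 {x₀ : E 2} {R : ℝ} (hR : 0 < R) {h : E 2 → ℝ}
    (hh : ContDiffOn ℝ (⊤ : ℕ∞) h (ball x₀ R \ {x₀}))
    (hl : ∀ x ∈ ball x₀ R \ {x₀}, lap h x = 0)
    (ho : h =o[𝓝[≠] x₀] fun x => Real.log (1 / ‖x - x₀‖)) :
    ∃ F : ℂ → ℂ, DifferentiableOn ℂ F (ball 0 R) ∧
      ∀ x ∈ ball x₀ R \ {x₀}, h x = (F (toC (x - x₀))).re := by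
  have hs : IsOpen (ball x₀ R \ {x₀}) := isOpen_ball.sdiff isClosed_singleton
  have h1 := harm_transfer (x₀ := x₀) hs hh hl
  have h2 := h1.mono (t := ball (0 : ℂ) R \ {0}) (by
    rintro z ⟨hz, hz0⟩
    refine ⟨by simpa using hz, ?_⟩
    simpa using hz0)
  have ht : Tendsto (fun z : ℂ => x₀ + toC.symm z) (𝓝[≠] 0) (𝓝[≠] x₀) := by
    rw [tendsto_nhdsWithin_iff]
    constructor
    · have : ContinuousAt (fun z : ℂ => x₀ + toC.symm z) 0 := by
        have := toC.symm.continuous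
        fun_prop
      have h := this.tendsto
      simp only [map_zero, add_zero] at h
      exact h.mono_left nhdsWithin_le_nhds
    · filter_upwards [self_mem_nhdsWithin] with z hz
      simpa using hz
  have h3 : (fun z : ℂ => h (x₀ + toC.symm z)) =o[𝓝[≠] 0] fun z => Real.log ‖z‖ := by
    have := (ho.comp_tendsto ht).neg_right
    refine this.congr_right ?_
    intro z
    simp
  obtain ⟨H, hH, hHU⟩ := harm_removable hR h2 h3
  refine ⟨H, hH, fun x hx => ?_⟩
  have := hHU (toC (x - x₀)) ⟨toC_mem hx.1, by simpa [sub_eq_zero] using hx.2⟩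
  simpa using this

lemma main_ball {x₀ : E 2} {R : ℝ} (hR : 0 < R) (m : ℕ) : ∀ {u : E 2 → ℝ},
    ContDiffOn ℝ (⊤ : ℕ∞) u (ball x₀ R \ {x₀}) →
    (∀ x ∈ ball x₀ R \ {x₀}, lap^[m] u x = 0) →
    (∀ k < m, (lap^[k] u) =o[𝓝[≠] x₀] fun x => Real.log (1 / ‖x - x₀‖)) →
    ∃ v : E 2 → ℝ, ContDiffOn ℝ (⊤ : ℕ∞) v (ball x₀ R) ∧
        (∀ x ∈ ball x₀ R, lap^[m] v x = 0) ∧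
        ∀ x ∈ ball x₀ R \ {x₀}, u x = v x := by
  have hs : IsOpen (ball x₀ R \ {x₀}) := isOpen_ball.sdiff isClosed_singleton
  have hsub : ball x₀ R \ {x₀} ⊆ ball x₀ R := Set.sdiff_subset
  induction m with
  | zero =>
    intro u _ h0 _
    exact ⟨fun _ => 0, contDiffOn_const, fun x _ => rfl, h0⟩
  | succ m ih =>
    intro u hu hp ho
    simp only [Function.iterate_succ_apply'] at hp
    obtain ⟨F, hF, hFu⟩ := harm_E2 hR (contDiffOn_lap_iter hs m hu) hp (ho m (Nat.lt_succ_self m))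
    obtain ⟨G, hG, hGF⟩ := exists_lap_iter (x₀ := x₀) m hF
    set w : E 2 → ℝ := fun y => (almC x₀ m G y).re with hw
    have hws : ContDiffOn ℝ (⊤ : ℕ∞) w (ball x₀ R) := almC_smooth m hG
    have hsubk : ∀ k, Set.EqOn (lap^[k] (fun x => u x - w x))
        (fun x => lap^[k] u x - lap^[k] w x) (ball x₀ R \ {x₀}) := fun k =>
      lap_iter_sub_on hs k hu (hws.mono hsub)
    obtain ⟨v, hv, hv0, huv⟩ := ih (u := fun x => u x - w x) (hu.sub (hws.mono hsub))
      (fun x hx => by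
        rw [hsubk m hx]
        simp only []
        rw [hFu x hx, hGF x hx.1, sub_self])
      (fun k hk => by
        have c1 : ContinuousAt (lap^[k] w) x₀ :=
          (diffAt_of_smooth isOpen_ball (contDiffOn_lap_iter isOpen_ball k hws)
            (mem_ball_self hR)).continuousAt
        refine ((ho k (by omega)).sub (bdd_littleO c1)).congr' ?_ EventuallyEq.rfl
        have : ball x₀ R \ {x₀} ∈ 𝓝[≠] x₀ :=
          inter_mem (mem_nhdsWithin_of_mem_nhds (ball_mem_nhds x₀ hR)) self_mem_nhdsWithin
        filter_upwards [this] with x hx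
        exact (hsubk k hx).symm)
    refine ⟨fun x => w x - (fun y => 0 - v y) x, hws.sub (contDiffOn_const.sub hv), ?_, ?_⟩
    · have hz : ∀ x ∈ ball x₀ R, lap^[m + 1] (fun y => 0 - v y) x = 0 := by
        simp only [Function.iterate_succ_apply']
        refine lap_zero_on isOpen_ball fun x hx => ?_
        rw [lap_iter_sub_on isOpen_ball m contDiffOn_const hv hx]
        simp only [hv0 x hx, sub_zero]
        have : ∀ k : ℕ, lap^[k] (fun _ : E 2 => (0 : ℝ)) = fun _ => 0 := by
          intro k
          induction k with
          | zero => rfl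
          | succ k ih =>
            rw [Function.iterate_succ_apply', ih]
            funext x
            simp [lap]
        rw [this]
      have hz2 : ∀ x ∈ ball x₀ R, lap^[m + 1] w x = 0 := by
        simp only [Function.iterate_succ_apply']
        intro x hx
        have e : Set.EqOn (lap^[m] w) (fun y => (almC x₀ 0 F y).re) (ball x₀ R) := by
          intro y hy
          rw [hGF y hy]
          simp [almC]
        rw [lap_congr_on isOpen_ball e hx, almC_lap 0 hF x hx]
        simp
      intro x hx
      rw [lap_iter_sub_on isOpen_ball (m + 1) hws (contDiffOn_const.sub hv) hx]
      simp only [hz x hx, hz2 x hx, sub_self]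
    · intro x hx
      have := huv x hx
      simp only [] at this ⊢
      linarith

/-- Theorem 1 (sufficiency, n = 2): if `Δᵐu = 0` on `Ω \ {x₀}` ⊂ ℝ² and
`|Δᵏu(x)| = o(log(1/|x-x₀|))` for all `k = 0,…,m-1`, then `u` has a removable
singularity at `x₀`. -/
theorem polyharmonic_removable_of_littleO_dim2 (m : ℕ) (hm : 2 ≤ m)
    (Ω : Set (E 2)) (hΩ : IsOpen Ω) (hΩc : IsConnected Ω)
    (x₀ : E 2) (hx₀ : x₀ ∈ Ω) (u : E 2 → ℝ)
    (hu : ContDiffOn ℝ (⊤ : ℕ∞) u (Ω \ {x₀}))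
    (hpoly : ∀ x ∈ Ω \ {x₀}, lap^[m] u x = 0)
    (ho : ∀ k < m, (lap^[k] u) =o[𝓝[≠] x₀] fun x => Real.log (1 / ‖x - x₀‖)) :
    ∃ δ > 0, closedBall x₀ δ ⊆ Ω ∧
      ∃ v : E 2 → ℝ, ContDiffOn ℝ (⊤ : ℕ∞) v (ball x₀ δ) ∧
        (∀ x ∈ ball x₀ δ, lap^[m] v x = 0) ∧
        ∀ x ∈ ball x₀ δ \ {x₀}, u x = v x := by
  obtain ⟨R, hR, hRΩ⟩ := Metric.nhds_basis_closedBall.mem_iff.1 (hΩ.mem_nhds hx₀)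
  have hsub : ball x₀ R \ {x₀} ⊆ Ω \ {x₀} :=
    Set.sdiff_subset_sdiff_left (ball_subset_closedBall.trans hRΩ)
  exact ⟨R, hR, hRΩ, main_ball hR m (hu.mono hsub) (fun x hx => hpoly x (hsub hx)) ho⟩
end

section
/- Let n = 2, m ≥ 2, and let u be a smooth solution of Δᵐu = 0 in Ω\{x₀} ⊂ ℝ² with |u(x)| = o(|x - x₀|^{2m-2} log(1/|x - x₀|)) as |x - x₀| → 0. Then u has a removable singularity at x₀. -/
open Metric Filter MeasureTheory Asymptotics
open scoped Topology

/-- Laplacian on ℂ by iterated partial derivatives. -/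
noncomputable def lapC (f : ℂ → ℝ) : ℂ → ℝ := fun z =>
  fderiv ℝ (fun y => fderiv ℝ f y 1) z 1 + fderiv ℝ (fun y => fderiv ℝ f y Complex.I) z Complex.I

open ComplexConjugate in
/-- Almansi type sum. -/
noncomputable def PA (c : ℂ) (m : ℕ) (f : ℕ → ℂ → ℂ) : ℂ → ℝ := fun z =>
  ∑ j ∈ Finset.range m, (conj (z - c) ^ j * f j z).re

section part1
open Complex ComplexConjugate InnerProductSpace

lemma two_le_smooth : (2 : WithTop ℕ∞) ≤ ((⊤ : ℕ∞) : WithTop ℕ∞) := by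
  exact WithTop.coe_le_coe.2 (le_top : (2 : ℕ∞) ≤ ⊤)

lemma lapC_eq_laplacian {f : ℂ → ℝ} {z : ℂ} (hf : ContDiffAt ℝ 2 f z) :
    lapC f z = Laplacian.laplacian f z := by
  rw [laplacian_eq_iteratedFDeriv_complexPlane]
  have h : DifferentiableAt ℝ (fderiv ℝ f) z :=
    (hf.fderiv_right (m := 1) (by norm_num)).differentiableAt (by norm_num)
  simp only [lapC, iteratedFDeriv_two_apply]
  rw [fderiv_clm_apply h (by fun_prop), fderiv_clm_apply h (by fun_prop)]
  simp

lemma lapC_congr {f g : ℂ → ℝ} {z : ℂ} (h : f =ᶠ[𝓝 z] g) : lapC f =ᶠ[𝓝 z] lapC g := by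
  filter_upwards [eventually_eventually_nhds.2 h] with y hy
  have hy : f =ᶠ[𝓝 y] g := hy
  have h1 : ∀ v, (fun y => fderiv ℝ f y v) =ᶠ[𝓝 y] (fun y => fderiv ℝ g y v) := by
    intro v
    filter_upwards [hy.fderiv (𝕜 := ℝ)] with w hw
    rw [hw]
  simp only [lapC]
  rw [(h1 1).fderiv_eq, (h1 I).fderiv_eq]

lemma lapC_iter_congr {f g : ℂ → ℝ} {z : ℂ} (m : ℕ) (h : f =ᶠ[𝓝 z] g) :
    lapC^[m] f =ᶠ[𝓝 z] lapC^[m] g := by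
  induction m generalizing f g with
  | zero => simpa using h
  | succ n ih =>
    simp only [Function.iterate_succ_apply]
    exact ih (lapC_congr h)

lemma lapC_add {f g : ℂ → ℝ} {z : ℂ} (hf : ContDiffAt ℝ 2 f z) (hg : ContDiffAt ℝ 2 g z) :
    lapC (fun z => f z + g z) z = lapC f z + lapC g z := by
  rw [lapC_eq_laplacian hf, lapC_eq_laplacian hg, lapC_eq_laplacian (hf.add hg)]
  exact hf.laplacian_add hg

lemma lapC_sub {f g : ℂ → ℝ} {z : ℂ} (hf : ContDiffAt ℝ 2 f z) (hg : ContDiffAt ℝ 2 g z) :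
    lapC (fun z => f z - g z) z = lapC f z - lapC g z := by
  rw [lapC_eq_laplacian hf, lapC_eq_laplacian hg, lapC_eq_laplacian (hf.sub hg)]
  exact hf.laplacian_sub hg

lemma lapC_sum {ι : Type*} (s : Finset ι) {f : ι → ℂ → ℝ} {z : ℂ}
    (hf : ∀ i ∈ s, ContDiffAt ℝ 2 (f i) z) :
    lapC (fun z => ∑ i ∈ s, f i z) z = ∑ i ∈ s, lapC (f i) z := by
  classical
  induction s using Finset.induction_on with
  | empty => simp [lapC]
  | insert a s ha ih =>
    simp only [Finset.sum_insert ha]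
    rw [lapC_add (hf a (by simp))
      (ContDiffAt.sum fun i hi => hf i (by simp [hi])), ih fun i hi => hf i (by simp [hi])]

lemma harmonicAt_of_lapC {f : ℂ → ℝ} {s : Set ℂ} (hs : IsOpen s)
    (hf : ContDiffOn ℝ 2 f s) (h : ∀ z ∈ s, lapC f z = 0) : HarmonicOnNhd f s := by
  intro z hz
  refine ⟨hf.contDiffAt (hs.mem_nhds hz), ?_⟩
  filter_upwards [hs.mem_nhds hz] with y hy
  rw [← lapC_eq_laplacian (hf.contDiffAt (hs.mem_nhds hy)), h y hy]
  rfl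

lemma contDiffOn_lapC {f : ℂ → ℝ} {s : Set ℂ} (hs : IsOpen s)
    (hf : ContDiffOn ℝ (⊤ : ℕ∞) f s) : ContDiffOn ℝ (⊤ : ℕ∞) (lapC f) s := by
  have key : ∀ (g : ℂ → ℝ), ContDiffOn ℝ (⊤ : ℕ∞) g s → ∀ v : ℂ,
      ContDiffOn ℝ (⊤ : ℕ∞) (fun y => fderiv ℝ g y v) s := by
    intro g hg v
    exact (hg.fderiv_of_isOpen hs (by simp)).clm_apply contDiffOn_const
  exact (key _ (key f hf 1) 1).add (key _ (key f hf I) I)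

/-- first derivative of the basic term -/
lemma hasFDerivAt_term {f : ℂ → ℂ} {f' c y : ℂ} (j : ℕ) (hf : HasDerivAt f f' y) :
    ∃ L : ℂ →L[ℝ] ℝ, HasFDerivAt (fun z => (conj (z - c) ^ j * f z).re) L y ∧
      ∀ v, L v = (conj (y - c) ^ (j - 1) * (j * conj v * f y)).re
        + (conj (y - c) ^ j * (f' * v)).re := by
  have h1 : HasFDerivAt (fun z : ℂ => conj (z - c)) (conjCLE : ℂ →L[ℝ] ℂ) y := by
    have := (conjCLE : ℂ →L[ℝ] ℂ).hasFDerivAt (x := y - c)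
    exact this.comp y ((hasFDerivAt_id y).sub_const c)
  have h2 := h1.pow j
  have h3 : HasFDerivAt f _ y := hf.hasFDerivAt.restrictScalars ℝ
  have h4 := reCLM.hasFDerivAt.comp y (h2.mul h3)
  refine ⟨_, h4, fun v => ?_⟩
  simp
  ring

lemma lapC_term {f : ℂ → ℂ} {c z : ℂ} {s : Set ℂ} (hs : IsOpen s) (hz : z ∈ s)
    (hf : DifferentiableOn ℂ f s) (j : ℕ) :
    lapC (fun z => (conj (z - c) ^ j * f z).re) z
      = (conj (z - c) ^ (j - 1) * (4 * j * deriv f z)).re := by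
  have hd : ∀ y ∈ s, HasDerivAt f (deriv f y) y := fun y hy =>
    (hf.differentiableAt (hs.mem_nhds hy)).hasDerivAt
  have hd2 : HasDerivAt (deriv f) (deriv (deriv f) z) z :=
    ((hf.deriv hs).differentiableAt (hs.mem_nhds hz)).hasDerivAt
  have key : ∀ v : ℂ, fderiv ℝ (fun y => fderiv ℝ (fun z => (conj (z - c) ^ j * f z).re) y v) z v
      = (conj (z - c) ^ (j - 1 - 1) * (((j - 1 : ℕ) : ℂ) * conj v * (j * conj v * f z))).re
        + (conj (z - c) ^ (j - 1) * (j * conj v * deriv f z * v)).re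
        + ((conj (z - c) ^ (j - 1) * (j * conj v * (deriv f z * v))).re
        + (conj (z - c) ^ j * (deriv (deriv f) z * v * v)).re) := by
    intro v
    have e : (fun y => fderiv ℝ (fun z => (conj (z - c) ^ j * f z).re) y v) =ᶠ[𝓝 z]
        fun y => (conj (y - c) ^ (j - 1) * (j * conj v * f y)).re
        + (conj (y - c) ^ j * (deriv f y * v)).re := by
      filter_upwards [hs.mem_nhds hz] with y hy
      obtain ⟨L, hL, hL'⟩ := hasFDerivAt_term (c := c) j (hd y hy)
      rw [hL.fderiv, hL']
    rw [e.fderiv_eq]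
    obtain ⟨L1, hL1, hL1'⟩ := hasFDerivAt_term (c := c) (j - 1) ((hd z hz).const_mul (j * conj v))
    obtain ⟨L2, hL2, hL2'⟩ := hasFDerivAt_term (c := c) j (hd2.mul_const v)
    rw [(hL1.fun_add hL2).fderiv]
    simp only [_root_.add_apply, hL1', hL2']
  simp only [lapC]
  rw [key 1, key I]
  simp only [← add_re]
  congr 1
  have : I ^ 2 = -1 := I_sq
  simp only [map_one, conj_I]
  linear_combination (conj (z - c) ^ (j - 1 - 1) * (((j - 1 : ℕ) : ℂ) *  (j *  f z))
     - 2 * (conj (z - c) ^ (j - 1) * (j *  (deriv f z))) + conj (z - c) ^ j * (deriv (deriv f) z))* this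

lemma contDiffAt_term {f : ℂ → ℂ} {c z : ℂ} {s : Set ℂ} (hs : IsOpen s) (hz : z ∈ s)
    (hf : DifferentiableOn ℂ f s) (j : ℕ) {n : WithTop ℕ∞} :
    ContDiffAt ℝ n (fun z => (conj (z - c) ^ j * f z).re) z := by
  have h1 : ContDiffAt ℝ n f z := (hf.analyticAt (hs.mem_nhds hz)).contDiffAt.restrict_scalars ℝ
  have h2 : ContDiffAt ℝ n (fun z : ℂ => conj (z - c)) z :=
    (conjCLE : ℂ →L[ℝ] ℂ).contDiff.contDiffAt.comp z (by fun_prop)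
  exact reCLM.contDiff.contDiffAt.comp z ((h2.pow j).mul h1)

lemma contDiffAt_PA {f : ℕ → ℂ → ℂ} {c z : ℂ} {s : Set ℂ} (hs : IsOpen s) (hz : z ∈ s) {m : ℕ}
    (hf : ∀ j < m, DifferentiableOn ℂ (f j) s) {n : WithTop ℕ∞} :
    ContDiffAt ℝ n (PA c m f) z :=
  ContDiffAt.sum fun i hi => contDiffAt_term hs hz (hf i (by simpa using hi)) i

lemma lapC_PA {f : ℕ → ℂ → ℂ} {c z : ℂ} {s : Set ℂ} (hs : IsOpen s) (hz : z ∈ s) {m : ℕ}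
    (hf : ∀ j < m + 1, DifferentiableOn ℂ (f j) s) :
    lapC (PA c (m + 1) f) z = PA c m (fun j z => 4 * (j + 1) * deriv (f (j + 1)) z) z := by
  unfold PA
  rw [lapC_sum _ fun i hi => contDiffAt_term hs hz (hf i (by simpa using hi)) i]
  rw [Finset.sum_congr rfl fun i hi => lapC_term hs hz (hf i (by simpa using hi)) i]
  rw [Finset.sum_range_succ']
  simp

lemma lapC_iter_PA {f : ℕ → ℂ → ℂ} {c : ℂ} {s : Set ℂ} (hs : IsOpen s) {m : ℕ}
    (hf : ∀ j < m, DifferentiableOn ℂ (f j) s) :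
    ∀ z ∈ s, lapC^[m] (PA c m f) z = 0 := by
  induction m generalizing f with
  | zero => intro z hz; simp [PA]
  | succ m ih =>
    intro z hz
    rw [Function.iterate_succ_apply]
    have e : lapC (PA c (m + 1) f) =ᶠ[𝓝 z]
        PA c m (fun j z => 4 * (j + 1) * deriv (f (j + 1)) z) := by
      filter_upwards [hs.mem_nhds hz] with y hy using lapC_PA hs hy hf
    rw [(lapC_iter_congr m e).eq_of_nhds]
    exact ih (fun j hj => ((hf (j + 1) (by lia)).deriv hs).const_mul _) z hz

/-- Solve the Poisson equation within the Almansi class. -/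
lemma exists_solve {f : ℕ → ℂ → ℂ} {c d : ℂ} {R : ℝ} {m : ℕ}
    (hf : ∀ j < m, DifferentiableOn ℂ (f j) (ball d R)) :
    ∃ F : ℕ → ℂ → ℂ, F 0 = 0 ∧ (∀ j < m + 1, DifferentiableOn ℂ (F j) (ball d R)) ∧
      ∀ z ∈ ball d R, lapC (PA c (m + 1) F) z = PA c m f z := by
  have h : ∀ j, ∃ G : ℂ → ℂ, j < m → ∀ z ∈ ball d R, HasDerivAt G (f j z) z := by
    intro j
    by_cases hj : j < m
    · obtain ⟨G, hG⟩ := (hf j hj).isExactOn_ball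
      exact ⟨G, fun _ => hG⟩
    · exact ⟨0, fun h => absurd h hj⟩
  choose G hG using h
  let F : ℕ → ℂ → ℂ := fun j => match j with
    | 0 => 0
    | j + 1 => fun z => (4 * ((j : ℂ) + 1))⁻¹ * G j z
  have hF : ∀ j < m, ∀ z ∈ ball d R, HasDerivAt (F (j + 1)) ((4 * ((j : ℂ) + 1))⁻¹ * f j z) z :=
    fun j hj z hz => (hG j hj z hz).const_mul _
  have hFd : ∀ j < m + 1, DifferentiableOn ℂ (F j) (ball d R) := by
    intro j hj
    cases j with
    | zero => exact differentiableOn_const 0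
    | succ j => exact fun z hz =>
        (hF j (by lia) z hz).differentiableAt.differentiableWithinAt
  refine ⟨F, rfl, hFd, fun z hz => ?_⟩
  rw [lapC_PA isOpen_ball hz hFd]
  unfold PA
  refine Finset.sum_congr rfl fun j hj => ?_
  beta_reduce
  rw [(hF j (by simpa using hj) z hz).deriv]
  have : (4 * ((j : ℂ) + 1)) ≠ 0 := by
    have : ((j : ℂ) + 1) ≠ 0 := by exact_mod_cast Nat.succ_ne_zero j
    simpa using this
  rw [mul_inv_cancel_left₀ this]

/-- Adding a holomorphic real part. -/
lemma PA_add_zero {F : ℕ → ℂ → ℂ} {c : ℂ} {m : ℕ} (hF : F 0 = 0) (H : ℂ → ℂ) (z : ℂ) :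
    PA c (m + 1) (fun j => if j = 0 then H else F j) z = (H z).re + PA c (m + 1) F z := by
  unfold PA
  rw [Finset.sum_range_succ', Finset.sum_range_succ']
  simp [hF]
  ring

/-- Local Almansi representation. -/
lemma almansi {c : ℂ} {R : ℝ} (m : ℕ) {u : ℂ → ℝ} (hu : ContDiffOn ℝ (⊤ : ℕ∞) u (ball c R))
    (h : ∀ z ∈ ball c R, lapC^[m] u z = 0) :
    ∃ f : ℕ → ℂ → ℂ, (∀ j < m, DifferentiableOn ℂ (f j) (ball c R)) ∧
      ∀ z ∈ ball c R, u z = PA c m f z := by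
  induction m generalizing u with
  | zero => exact ⟨0, by simp, fun z hz => by simpa [PA] using h z hz⟩
  | succ m ih =>
    obtain ⟨f, hf, hfe⟩ := ih (contDiffOn_lapC isOpen_ball hu) h
    obtain ⟨F, hF0, hF, hFe⟩ := exists_solve (c := c) hf
    have hc : ∀ z ∈ ball c R, ContDiffAt ℝ 2 u z := fun z hz =>
      (hu.contDiffAt (isOpen_ball.mem_nhds hz)).of_le two_le_smooth
    have hP : ∀ z ∈ ball c R, ContDiffAt ℝ 2 (PA c (m + 1) F) z := fun z hz =>
      contDiffAt_PA isOpen_ball hz hF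
    have hh : HarmonicOnNhd (fun z => u z - PA c (m + 1) F z) (ball c R) := by
      refine harmonicAt_of_lapC isOpen_ball
        (fun z hz => ((hc z hz).sub (hP z hz)).contDiffWithinAt) fun z hz => ?_
      rw [lapC_sub (hc z hz) (hP z hz), hFe z hz, hfe z hz, sub_self]
    obtain ⟨H, hH, hHe⟩ := hh.exists_analyticOnNhd_ball_re_eq
    refine ⟨fun j => if j = 0 then H else F j, fun j hj => ?_, fun z hz => ?_⟩
    · by_cases h0 : j = 0
      · simpa [h0] using hH.differentiableOn
      · simpa [h0] using hF j hj
    · have := hHe hz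
      simp only at this
      rw [PA_add_zero hF0, this]
      ring

end part1

section part2
open Complex ComplexConjugate InnerProductSpace

lemma circleAverage_term {f : ℂ → ℂ} {c : ℂ} {R s : ℝ} (hs : 0 < s) (hsR : s < R)
    (hf : DifferentiableOn ℂ f (ball c R)) (j : ℕ) :
    Real.circleAverage (fun z => (conj (z - c) ^ j * f z).re) c s
      = s ^ (2 * j) * ((iteratedDeriv j f c).re / j.factorial) := by
  have hsub : closedBall c s ⊆ ball c R := closedBall_subset_ball hsR
  have hcont : ContinuousOn (fun z => conj (z - c) ^ j * f z) (sphere c |s|) := by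
    have h1 : ContinuousOn f (sphere c |s|) := by
      rw [abs_of_pos hs]
      exact hf.continuousOn.mono (sphere_subset_closedBall.trans hsub)
    have h2 : Continuous (fun z : ℂ => conj (z - c) ^ j) := by fun_prop
    exact h2.continuousOn.mul h1
  have h1 : Real.circleAverage (fun z => (conj (z - c) ^ j * f z).re) c s
      = (Real.circleAverage (fun z => conj (z - c) ^ j * f z) c s).re :=
    reCLM.circleAverage_comp_comm (hcont.circleIntegrable')
  rw [h1, Real.circleAverage_eq_circleIntegral hs.ne']
  have h2 : (∮ z in C(c, s), (z - c)⁻¹ • (conj (z - c) ^ j * f z))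
      = ∮ z in C(c, s), ((s : ℂ) ^ (2 * j)) • ((1 / (z - c) ^ (j + 1)) • f z) := by
    refine circleIntegral.integral_congr hs.le fun z hz => ?_
    have hn : ‖z - c‖ = s := by simpa [dist_eq_norm] using hz
    have hz0 : z - c ≠ 0 := by
      intro h; rw [h] at hn; simp at hn; exact hs.ne hn
    have hc : conj (z - c) = (s : ℂ) ^ 2 / (z - c) := by
      rw [eq_div_iff hz0, mul_comm, mul_conj, normSq_eq_norm_sq, hn]
      push_cast; rfl
    simp only [smul_eq_mul]
    rw [hc, div_pow, pow_succ (z - c), ← pow_mul]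
    field_simp
  rw [h2, circleIntegral.integral_smul,
    (hf.diffContOnCl_ball hsub).circleIntegral_one_div_sub_center_pow_smul hs]
  have h3 : (2 * (Real.pi : ℂ) * I)⁻¹ • (s : ℂ) ^ (2 * j) •
      (2 * (Real.pi : ℂ) * I / (j.factorial : ℂ)) • iteratedDeriv j f c
      = ((s ^ (2 * j) / j.factorial : ℝ) : ℂ) * iteratedDeriv j f c := by
    have : (Real.pi : ℂ) ≠ 0 := by exact_mod_cast Real.pi_ne_zero
    have : (j.factorial : ℂ) ≠ 0 := by exact_mod_cast j.factorial_ne_zero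
    have := I_ne_zero
    simp only [smul_eq_mul]
    push_cast
    field_simp
  rw [h3, re_ofReal_mul]
  ring

lemma circleAverage_PA {f : ℕ → ℂ → ℂ} {c : ℂ} {R s : ℝ} (hs : 0 < s) (hsR : s < R) {m : ℕ}
    (hf : ∀ j < m, DifferentiableOn ℂ (f j) (ball c R)) :
    Real.circleAverage (PA c m f) c s
      = ∑ j ∈ Finset.range m, s ^ (2 * j) * ((iteratedDeriv j (f j) c).re / j.factorial) := by
  unfold PA
  rw [Real.circleAverage_fun_sum]
  · exact Finset.sum_congr rfl fun j hj => circleAverage_term hs hsR (hf j (by simpa using hj)) j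
  · intro j hj
    apply ContinuousOn.circleIntegrable hs.le
    intro z hz
    exact (contDiffAt_term (n := 0) isOpen_ball
      (closedBall_subset_ball hsR (sphere_subset_closedBall hz))
      (hf j (by simpa using hj)) j).continuousAt.continuousWithinAt

lemma coeff_bound (m : ℕ) (hm : 1 < m) : ∃ C : ℝ, 0 ≤ C ∧ ∀ (a : ℕ → ℝ) (M ρ : ℝ), 0 < ρ →
    (∀ s, 0 < s → s < ρ → |∑ j ∈ Finset.range m, s ^ (2 * j) * a j| ≤ M) →
    |a 1| ≤ C * M / ρ ^ 2 := by
  classical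
  let v : ℕ → ℝ := fun i => (((i : ℝ) + 1) / (m + 1)) ^ 2
  have hv : Set.InjOn v (Finset.range m : Finset ℕ) := by
    intro i _ k _ h
    have h1 : ((i : ℝ) + 1) / (m + 1) = ((k : ℝ) + 1) / (m + 1) :=
      (pow_left_inj₀ (by positivity) (by positivity) two_ne_zero).1 h
    have h2 : (0 : ℝ) < m + 1 := by positivity
    have h3 := (div_left_inj' h2.ne').1 h1
    exact_mod_cast add_right_cancel h3
  let B : ℕ → ℝ := fun i => (Lagrange.basis (Finset.range m) v i).coeff 1
  refine ⟨∑ i ∈ Finset.range m, |B i|, Finset.sum_nonneg fun _ _ => abs_nonneg _, ?_⟩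
  intro a M ρ hρ h
  let P : Polynomial ℝ := ∑ j ∈ Finset.range m, Polynomial.C (ρ ^ (2 * j) * a j) * Polynomial.X ^ j
  have hPd : P.degree < (Finset.range m).card := by
    rw [Finset.card_range]
    refine (Polynomial.degree_lt_iff_coeff_zero _ _).2 fun k hk => ?_
    simp only [P, Polynomial.finsetSum_coeff, Polynomial.coeff_C_mul, Polynomial.coeff_X_pow]
    refine Finset.sum_eq_zero fun i hi => ?_
    have : k ≠ i := by have := Finset.mem_range.1 hi; lia
    simp [this]
  have hP1 : P.coeff 1 = ρ ^ 2 * a 1 := by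
    simp only [P, Polynomial.finsetSum_coeff, Polynomial.coeff_C_mul, Polynomial.coeff_X_pow]
    simp [hm]
  have hPe : ∀ i < m, |P.eval (v i)| ≤ M := by
    intro i hi
    have hi' : ((i : ℝ) + 1) < m + 1 := by exact_mod_cast Nat.succ_lt_succ hi
    have h2 : (0 : ℝ) < m + 1 := by positivity
    have := h (ρ * (((i : ℝ) + 1) / (m + 1))) (by positivity) (by
      have : ((i : ℝ) + 1) / (m + 1) < 1 := (div_lt_one h2).2 hi'
      nlinarith)
    convert this using 2
    simp only [P, Polynomial.eval_finsetSum, Polynomial.eval_mul, Polynomial.eval_C,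
      Polynomial.eval_pow, Polynomial.eval_X, v]
    refine Finset.sum_congr rfl fun j _ => ?_
    rw [mul_pow, ← pow_mul]
    ring
  have e := congrArg (fun Q => Polynomial.coeff Q 1) (Lagrange.eq_interpolate hv hPd)
  simp only [Lagrange.interpolate_apply, Polynomial.finsetSum_coeff, Polynomial.coeff_C_mul] at e
  rw [hP1] at e
  rw [le_div_iff₀ (by positivity)]
  calc |a 1| * ρ ^ 2 = |ρ ^ 2 * a 1| := by rw [abs_mul, abs_of_pos (pow_pos hρ 2)]; ring
    _ ≤ ∑ i ∈ Finset.range m, |P.eval (v i) * B i| := by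
      rw [e]; exact Finset.abs_sum_le_sum_abs _ _
    _ ≤ ∑ i ∈ Finset.range m, M * |B i| := by
      refine Finset.sum_le_sum fun i hi => ?_
      rw [abs_mul]
      exact mul_le_mul_of_nonneg_right (hPe i (by simpa using hi)) (abs_nonneg _)
    _ = _ := by rw [← Finset.mul_sum, mul_comm]

lemma lapC_bound (m : ℕ) (hm : 1 < m) : ∃ C : ℝ, 0 ≤ C ∧ ∀ (u : ℂ → ℝ) (c : ℂ) (M ρ : ℝ), 0 < ρ →
    ContDiffOn ℝ (⊤ : ℕ∞) u (ball c ρ) → (∀ z ∈ ball c ρ, lapC^[m] u z = 0) →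
    (∀ z ∈ ball c ρ, |u z| ≤ M) → |lapC u c| ≤ C * M / ρ ^ 2 := by
  obtain ⟨C, hC, hCb⟩ := coeff_bound m hm
  refine ⟨4 * C, by positivity, ?_⟩
  intro u c M ρ hρ hu hz hM
  obtain ⟨f, hf, hfe⟩ := almansi m hu hz
  have hc : c ∈ ball c ρ := mem_ball_self hρ
  have h1 : lapC u c = 4 * (deriv (f 1) c).re := by
    have e : u =ᶠ[𝓝 c] PA c m f := by
      filter_upwards [isOpen_ball.mem_nhds hc] with y hy using hfe y hy
    rw [(lapC_congr e).eq_of_nhds]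
    obtain ⟨k, rfl⟩ : ∃ k, m = k + 1 + 1 := ⟨m - 2, by lia⟩
    rw [lapC_PA isOpen_ball hc hf, PA, Finset.sum_range_succ']
    simp
  have h2 := hCb (fun j => (iteratedDeriv j (f j) c).re / j.factorial) M ρ hρ (by
    intro s hs hsρ
    rw [← circleAverage_PA hs hsρ hf]
    have hsub : sphere c |s| ⊆ ball c ρ := by
      rw [abs_of_pos hs]
      exact sphere_subset_closedBall.trans (closedBall_subset_ball hsρ)
    have hci : CircleIntegrable (PA c m f) c s := by
      apply ContinuousOn.circleIntegrable'
      intro z hz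
      exact (contDiffAt_PA (n := 0) isOpen_ball (hsub hz) hf).continuousAt.continuousWithinAt
    refine Real.abs_circleAverage_le_circleAverage_abs.trans ?_
    refine Real.circleAverage_mono_on_of_le_circle hci.abs fun z hz => ?_
    simpa [← hfe z (hsub hz)] using hM z (hsub hz))
  simp only [iteratedDeriv_one, Nat.factorial_one, Nat.cast_one, div_one] at h2
  rw [h1, abs_mul, abs_of_pos (by norm_num : (0 : ℝ) < 4)]
  calc _ ≤ 4 * (C * M / ρ ^ 2) := by gcongr
    _ = _ := by ring

/-- gradient estimate for harmonic functions -/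
lemma grad_bound {h : ℂ → ℝ} {c : ℂ} {M ρ : ℝ} (hρ : 0 < ρ) (hM0 : 0 < M)
    (hh : HarmonicOnNhd h (ball c ρ)) (hM : ∀ z ∈ ball c ρ, |h z| ≤ M) :
    ‖(fderiv ℝ h c 1 : ℂ) - I * fderiv ℝ h c I‖ ≤ 8 * M / ρ := by
  obtain ⟨F, hF, hFe⟩ := hh.exists_analyticOnNhd_ball_re_eq
  have hc : c ∈ ball c ρ := mem_ball_self hρ
  have hFd := hF.differentiableOn
  have hd : HasDerivAt F (deriv F c) c := (hF c hc).differentiableAt.hasDerivAt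
  have h1 : (fderiv ℝ h c 1 : ℂ) - I * fderiv ℝ h c I = deriv F c := by
    have e : h =ᶠ[𝓝 c] fun z => (F z).re := by
      filter_upwards [isOpen_ball.mem_nhds hc] with y hy using (hFe hy).symm
    obtain ⟨L, hL, hL'⟩ := hasFDerivAt_term (c := 0) 0 hd
    simp only [pow_zero, one_mul] at hL
    rw [e.fderiv_eq, hL.fderiv, hL', hL']
    apply Complex.ext <;> simp
  rw [h1]
  have h2 : ∀ z ∈ sphere c (ρ / 2), ‖F z - F c‖ ≤ 4 * M := by
    intro z hz
    have hn : ‖z - c‖ = ρ / 2 := by simpa [dist_eq_norm] using hz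
    have hmaps : ∀ w ∈ ball (0 : ℂ) ρ, c + w ∈ ball c ρ := by
      intro w hw; simpa [dist_eq_norm] using hw
    have := borelCaratheodory_zero (f := fun w => F (c + w) - F c) (M := 2 * M) (R := ρ)
      (z := z - c) (by positivity) (by
        refine DifferentiableOn.sub_const ?_ _
        exact hFd.comp (by fun_prop) hmaps) (by
        intro w hw
        have e1 : (F (c + w)).re = h (c + w) := hFe (hmaps w hw)
        have e2 : (F c).re = h c := hFe hc
        simp only [Set.mem_ofPred_eq, sub_re, e1, e2]
        have := abs_le.1 (hM _ (hmaps w hw))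
        have := abs_le.1 (hM c hc)
        linarith) hρ (by rw [mem_ball_zero_iff, hn]; linarith) (by simp)
    rw [hn] at this
    simp only [add_sub_cancel] at this
    calc _ ≤ _ := this
      _ = 4 * M := by field_simp; ring
  have h3 := norm_deriv_le_of_forall_mem_sphere_norm_le (f := fun z => F z - F c) (c := c)
    (half_pos hρ) ((hFd.sub_const _).diffContOnCl_ball
      (closedBall_subset_ball (half_lt_self hρ))) h2
  rw [deriv_sub_const] at h3
  calc _ ≤ _ := h3
    _ = _ := by field_simp; ring

end part2

section part3
open Complex ComplexConjugate InnerProductSpace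

lemma log_abs_compare {a b : ℝ} (ha : 0 < a) (ha2 : a < 1 / 2) (h1 : a / 2 < b)
    (h2 : b < 2 * a) : |Real.log b| ≤ 2 * |Real.log a| := by
  have hb : 0 < b := by linarith
  have hl2 : Real.log a ≤ - Real.log 2 := by
    rw [← Real.log_inv]
    exact Real.log_le_log ha (by linarith)
  have hl2' : 0 < Real.log 2 := Real.log_pos (by norm_num)
  have e1 : Real.log a - Real.log 2 ≤ Real.log b := by
    rw [← Real.log_div ha.ne' two_ne_zero]
    exact Real.log_le_log (by linarith) h1.le
  have e2 : Real.log b ≤ Real.log 2 + Real.log a := by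
    rw [← Real.log_mul two_ne_zero ha.ne']
    exact Real.log_le_log hb h2.le
  rw [abs_of_neg (by linarith : Real.log a < 0)]
  rw [abs_le]
  constructor <;> linarith

lemma near_ball {z w : ℂ} (hw : w ∈ ball z (‖z‖ / 2)) : ‖z‖ / 2 < ‖w‖ ∧ ‖w‖ < 2 * ‖z‖ := by
  rw [mem_ball, dist_eq_norm] at hw
  have h1 := norm_sub_norm_le z w
  have h2 := norm_sub_norm_le w z
  rw [norm_sub_rev] at h1
  have := norm_nonneg z
  constructor <;> linarith

lemma eventually_punctured {p : ℂ → Prop} : (∀ᶠ z in 𝓝[≠] (0 : ℂ), p z) ↔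
    ∃ δ > 0, ∀ z : ℂ, z ≠ 0 → ‖z‖ < δ → p z := by
  rw [eventually_nhdsWithin_iff, Metric.eventually_nhds_iff]
  simp only [dist_zero_right, Set.mem_compl_iff, Set.mem_singleton_iff]
  exact ⟨fun ⟨δ, h, H⟩ => ⟨δ, h, fun z a b => H b a⟩, fun ⟨δ, h, H⟩ => ⟨δ, h, fun z a b => H z b a⟩⟩

lemma tendsto_log_norm : Tendsto (fun z : ℂ => Real.log ‖z‖) (𝓝[≠] 0) atBot :=
  Real.tendsto_log_nhdsGT_zero.comp tendsto_norm_nhdsNE_zero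

lemma log_isLittleO_inv :
    (fun z : ℂ => Real.log ‖z‖) =o[𝓝[≠] (0 : ℂ)] fun z => z⁻¹ := by
  have h : (fun x : ℝ => Real.log x) =o[𝓝[>] 0] fun x => x ^ (-1 : ℝ) :=
    isLittleO_log_rpow_nhdsGT_zero (by norm_num)
  have h2 := h.comp_tendsto (tendsto_norm_nhdsNE_zero (E := ℂ))
  rw [← isLittleO_norm_right]
  refine h2.congr_right fun z => ?_
  simp [Real.rpow_neg_one]

lemma harmonic_removable {h : ℂ → ℝ} {R : ℝ} (hR : 0 < R)
    (hh : HarmonicOnNhd h (ball 0 R \ {0}))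
    (ho : h =o[𝓝[≠] (0 : ℂ)] fun z => Real.log ‖z‖) :
    ∃ H : ℂ → ℂ, DifferentiableOn ℂ H (ball 0 R) ∧ ∀ z ∈ ball 0 R \ {0}, h z = (H z).re := by
  set g : ℂ → ℂ := fun z => fderiv ℝ h z 1 - I * fderiv ℝ h z I with hg
  have hgd : DifferentiableOn ℂ g (ball 0 R \ {0}) := fun z hz =>
    (HarmonicAt.differentiableAt_complex_partial (hh z hz)).differentiableWithinAt
  have hball : ball (0 : ℂ) R ∈ 𝓝 (0 : ℂ) := ball_mem_nhds 0 hR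
  set q : ℂ → ℂ := fun z => z * g z with hq
  have hqd : DifferentiableOn ℂ q (ball 0 R \ {0}) := differentiableOn_id.mul hgd
  have hqo : (fun z => q z - q 0) =o[𝓝[≠] (0 : ℂ)] fun z => (z - 0)⁻¹ := by
    rw [isLittleO_iff]
    intro ε hε
    have h1 := (isLittleO_iff.1 (ho.trans log_isLittleO_inv)) (show 0 < ε / 32 by positivity)
    obtain ⟨δ, hδ, H⟩ := eventually_punctured.1 h1
    refine eventually_punctured.2 ⟨min (δ / 2) (R / 2), by positivity, fun z hz hzδ => ?_⟩
    have hz0 : 0 < ‖z‖ := norm_pos_iff.2 hz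
    have hzδ1 := hzδ.trans_le (min_le_left _ _)
    have hzδ2 := hzδ.trans_le (min_le_right _ _)
    have hb := grad_bound (h := h) (c := z) (M := ε / 16 * ‖z‖⁻¹) (ρ := ‖z‖ / 2)
      (by positivity) (by positivity)
      (hh.mono fun w hw => by
        have := near_ball hw
        refine ⟨by rw [mem_ball_zero_iff]; linarith, ?_⟩
        rintro rfl
        simp at this; linarith)
      (fun w hw => by
        have := near_ball hw
        have hw0 : w ≠ 0 := by rintro rfl; simp at this; linarith
        have h3 := H w hw0 (by linarith)
        rw [Real.norm_eq_abs, norm_inv] at h3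
        refine h3.trans ?_
        have : ‖w‖⁻¹ ≤ (‖z‖ / 2)⁻¹ := inv_anti₀ (by positivity) this.1.le
        calc _ ≤ ε / 32 * (‖z‖ / 2)⁻¹ := by gcongr
          _ = _ := by field_simp; ring)
    have e : q z - q 0 = z * g z := by simp [hq]
    rw [e, norm_mul, sub_zero, norm_inv]
    calc ‖z‖ * ‖g z‖ ≤ ‖z‖ * (8 * (ε / 16 * ‖z‖⁻¹) / (‖z‖ / 2)) := by gcongr
      _ = ε * ‖z‖⁻¹ := by field_simp; norm_num
  have hQd := differentiableOn_update_limUnder_of_isLittleO hball hqd hqo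
  set Q := Function.update q 0 (limUnder (𝓝[≠] 0) q) with hQ
  have hkd : DifferentiableOn ℂ (dslope Q 0) (ball 0 R) := (differentiableOn_dslope hball).2 hQd
  obtain ⟨K, hK⟩ := hkd.isExactOn_ball
  set a := Q 0 with ha
  have hgk : ∀ z, z ≠ 0 → g z = a / z + dslope Q 0 z := by
    intro z hz
    rw [dslope_of_ne _ hz, slope_def_field]
    have : Q z = z * g z := by simp [hQ, hz, hq]
    rw [this]
    field_simp
    ring
  -- derivative along a path
  have path : ∀ (γ : ℝ → ℂ) (γ' : ℂ) (t : ℝ), HasDerivAt γ γ' t → γ t ∈ ball (0 : ℂ) R \ {0} →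
      HasDerivAt (fun s => h (γ s) - (K (γ s)).re) (a / γ t * γ').re t := by
    intro γ γ' t hγ hm
    have d1 : HasFDerivAt h (fderiv ℝ h (γ t)) (γ t) :=
      ((hh _ hm).1.differentiableAt (by norm_num)).hasFDerivAt
    have d2 := d1.comp_hasDerivAt t hγ
    obtain ⟨L, hL, hL'⟩ := hasFDerivAt_term (c := 0) 0 (hK _ hm.1)
    simp only [pow_zero, one_mul] at hL
    have d3 := hL.comp_hasDerivAt t hγ
    refine (d2.sub d3).congr_deriv ?_
    have e1 : fderiv ℝ h (γ t) γ' = (g (γ t) * γ').re := by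
      conv_lhs => rw [← re_add_im γ']
      have : ((γ'.re : ℂ) + γ'.im * I) = γ'.re • (1 : ℂ) + γ'.im • I := by simp
      rw [this, map_add, map_smul, map_smul]
      simp [hg]
      ring
    rw [e1, hL', hgk _ hm.2]
    simp
    ring
  -- constancy on circles
  have circ : ∀ r, 0 < r → r < R → ∀ θ : ℝ,
      h (circleMap 0 r θ) - (K (circleMap 0 r θ)).re + a.im * θ = h r - (K r).re := by
    intro r hr hrR θ
    have hd : ∀ θ : ℝ, HasDerivAt
        (fun θ : ℝ => h (circleMap 0 r θ) - (K (circleMap 0 r θ)).re + a.im * θ) 0 θ := by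
      intro θ
      have hne : circleMap 0 r θ ≠ 0 := by simp [circleMap, hr.ne']
      have hmem : circleMap 0 r θ ∈ ball (0 : ℂ) R \ {0} := by
        refine ⟨?_, hne⟩
        rw [mem_ball_zero_iff, norm_circleMap_zero, abs_of_pos hr]; exact hrR
      have := (path _ _ θ (hasDerivAt_circleMap 0 r θ) hmem).add
        ((hasDerivAt_id θ).const_mul a.im)
      refine this.congr_deriv ?_
      rw [div_mul_eq_mul_div, ← mul_assoc, mul_right_comm, mul_div_assoc, div_self hne]
      simp
    have := is_const_of_deriv_eq_zero (fun θ => (hd θ).differentiableAt) (fun θ => (hd θ).deriv) θ 0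
    simpa [circleMap] using this
  have him : a.im = 0 := by
    have h1 := circ (R / 2) (by linarith) (by linarith) (2 * Real.pi)
    have h2 := circ (R / 2) (by linarith) (by linarith) 0
    have : circleMap 0 (R / 2) (2 * Real.pi) = circleMap 0 (R / 2) 0 := by
      simpa using periodic_circleMap 0 (R / 2) 0
    rw [this] at h1
    have : a.im * (2 * Real.pi) = 0 := by linarith
    simpa [Real.pi_ne_zero] using this
  -- radial behaviour
  have rad : ∃ B : ℝ, ∀ r : ℝ, 0 < r → r < R → h r - (K r).re - a.re * Real.log r = B := by
    have hd : ∀ r ∈ Set.Ioo 0 R, HasDerivAt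
        (fun r : ℝ => h r - (K r).re - a.re * Real.log r) 0 r := by
      intro r hr
      have hmem : (r : ℂ) ∈ ball (0 : ℂ) R \ {0} := by
        refine ⟨?_, ?_⟩
        · rw [mem_ball_zero_iff, norm_real, Real.norm_eq_abs, abs_of_pos hr.1]; exact hr.2
        · simpa using hr.1.ne'
      have := (path (fun r => (r : ℂ)) 1 r (ofRealCLM.hasDerivAt) hmem).sub
        ((Real.hasDerivAt_log hr.1.ne').const_mul a.re)
      refine this.congr_deriv ?_
      rw [mul_one, div_ofReal_re]
      ring
    refine ⟨h ((R / 2 : ℝ) : ℂ) - (K ((R / 2 : ℝ) : ℂ)).re - a.re * Real.log (R / 2), fun r h1 h2 => ?_⟩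
    exact isOpen_Ioo.is_const_of_deriv_eq_zero isPreconnected_Ioo
      (fun r hr => (hd r hr).differentiableAt.differentiableWithinAt)
      (fun r hr => (hd r hr).deriv) ⟨h1, h2⟩ (y := R / 2) ⟨by linarith, by linarith⟩
  obtain ⟨B, hB⟩ := rad
  have hre : a.re = 0 := by
    have hγ : Tendsto (fun r : ℝ => (r : ℂ)) (𝓝[>] 0) (𝓝[≠] 0) := by
      refine tendsto_nhdsWithin_iff.2 ⟨?_, ?_⟩
      · exact (continuous_ofReal.tendsto' 0 0 (by simp)).mono_left nhdsWithin_le_nhds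
      · filter_upwards [self_mem_nhdsWithin] with r hr
        simpa using (ne_of_gt hr)
    have ho1 : (fun r : ℝ => h r) =o[𝓝[>] 0] Real.log := by
      refine (ho.comp_tendsto hγ).congr' EventuallyEq.rfl ?_
      filter_upwards [self_mem_nhdsWithin] with r hr
      simp
    have hlog : Tendsto (fun r : ℝ => ‖Real.log r‖) (𝓝[>] 0) atTop :=
      tendsto_abs_atBot_atTop.comp Real.tendsto_log_nhdsGT_zero
    have hKc : ContinuousAt (fun z => (K z).re + B) 0 :=
      (continuous_re.continuousAt.comp (hK 0 (mem_ball_self hR)).continuousAt).add continuousAt_const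
    have hKO : (fun r : ℝ => (K r).re + B) =O[𝓝[>] 0] (fun _ => (1 : ℝ)) :=
      (hKc.tendsto.mono_left nhdsWithin_le_nhds |>.comp hγ).isBigO_one ℝ
    have ho2 : (fun r : ℝ => (K r).re + B) =o[𝓝[>] 0] Real.log :=
      hKO.trans_isLittleO ((isLittleO_const_left.2 (Or.inr hlog)))
    have ho3 : (fun r : ℝ => a.re * Real.log r) =o[𝓝[>] 0] Real.log := by
      refine (ho1.sub ho2).congr' ?_ EventuallyEq.rfl
      filter_upwards [Ioo_mem_nhdsGT hR] with r hr
      have := hB r hr.1 hr.2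
      linarith
    by_contra hne
    have := (isLittleO_const_mul_left_iff hne).1 ho3
    have h4 := isLittleO_irrefl (f'' := Real.log) (l := 𝓝[>] (0 : ℝ)) (by
      apply Eventually.frequently
      filter_upwards [hlog.eventually_gt_atTop 0] with r hr
      exact norm_pos_iff.1 hr)
    exact h4 this
  refine ⟨fun z => K z + B, fun z hz =>
    ((hK z hz).differentiableAt.add_const _).differentiableWithinAt, fun z hz => ?_⟩
  have hz0 : 0 < ‖z‖ := norm_pos_iff.2 hz.2
  have hzR : ‖z‖ < R := mem_ball_zero_iff.1 hz.1
  have h1 := circ ‖z‖ hz0 hzR (arg z)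
  have h2 := hB ‖z‖ hz0 hzR
  have : circleMap 0 ‖z‖ (arg z) = z := by simp [circleMap]
  rw [this, him] at h1
  rw [hre] at h2
  simp
  linarith

lemma punctured_main {R : ℝ} (hR : 0 < R) (n : ℕ) {u : ℂ → ℝ}
    (hu : ContDiffOn ℝ (⊤ : ℕ∞) u (ball 0 R \ {0}))
    (h : ∀ z ∈ ball (0 : ℂ) R \ {0}, lapC^[n + 1] u z = 0)
    (ho : u =o[𝓝[≠] (0 : ℂ)] fun z => ‖z‖ ^ (2 * n) * Real.log ‖z‖) :
    ∃ f : ℕ → ℂ → ℂ, (∀ j < n + 1, DifferentiableOn ℂ (f j) (ball 0 R)) ∧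
      ∀ z ∈ ball (0 : ℂ) R \ {0}, u z = PA 0 (n + 1) f z := by
  have hop : IsOpen (ball (0 : ℂ) R \ {0}) := isOpen_ball.sdiff isClosed_singleton
  induction n generalizing u with
  | zero =>
    obtain ⟨H, hH, hHe⟩ := harmonic_removable hR
      (harmonicAt_of_lapC hop (hu.of_le two_le_smooth) (by simpa using h)) (by simpa using ho)
    exact ⟨fun _ => H, fun _ _ => hH, fun z hz => by simpa [PA] using hHe z hz⟩
  | succ n ih =>
    have hlo : lapC u =o[𝓝[≠] (0 : ℂ)] fun z => ‖z‖ ^ (2 * n) * Real.log ‖z‖ := by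
      obtain ⟨C, hC, hCb⟩ := lapC_bound (n + 2) (by lia)
      rw [isLittleO_iff]
      intro ε hε
      have h1 := (isLittleO_iff.1 ho)
        (show 0 < ε / ((C + 1) * 2 ^ (2 * n + 5)) by positivity)
      set η := ε / ((C + 1) * 2 ^ (2 * n + 5)) with hη
      have hη0 : 0 < η := by positivity
      obtain ⟨δ, hδ, H⟩ := eventually_punctured.1 h1
      refine eventually_punctured.2 ⟨min (min (δ / 2) (R / 2)) (1 / 2), by positivity,
        fun z hz hzδ => ?_⟩
      have hz0 : 0 < ‖z‖ := norm_pos_iff.2 hz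
      obtain ⟨hzδ', hzδ3⟩ := lt_min_iff.1 hzδ
      obtain ⟨hzδ1, hzδ2⟩ := lt_min_iff.1 hzδ'
      have hsub : ball z (‖z‖ / 2) ⊆ ball 0 R \ {0} := fun w hw => by
        have := near_ball hw
        refine ⟨by rw [mem_ball_zero_iff]; linarith, ?_⟩
        rintro rfl
        simp at this; linarith
      have hb := hCb u z (η * ((2 * ‖z‖) ^ (2 * (n + 1)) * (2 * |Real.log ‖z‖|))) (‖z‖ / 2)
        (by positivity) (hu.mono hsub) (fun w hw => h w (hsub hw)) (fun w hw => by
          have hn := near_ball hw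
          have h3 := H w (hsub hw).2 (by linarith)
          rw [Real.norm_eq_abs] at h3
          refine h3.trans ?_
          rw [norm_mul, Real.norm_eq_abs (Real.log _), norm_pow, norm_norm]
          have := log_abs_compare hz0 hzδ3 hn.1 hn.2
          have := hn.2.le
          gcongr)
      rw [Real.norm_eq_abs]
      refine hb.trans ?_
      rw [norm_mul, Real.norm_eq_abs (Real.log _), norm_pow, norm_norm]
      have e : C * (η * ((2 * ‖z‖) ^ (2 * (n + 1)) * (2 * |Real.log ‖z‖|))) / (‖z‖ / 2) ^ 2
          = (C * η * 2 ^ (2 * n + 5)) * (‖z‖ ^ (2 * n) * |Real.log ‖z‖|) := by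
        rw [show 2 * (n + 1) = 2 * n + 2 by ring, mul_pow]
        field_simp
        ring
      rw [e]
      gcongr
      rw [hη]
      have : (0 : ℝ) < C + 1 := by linarith
      rw [mul_div_assoc', div_mul_eq_mul_div, div_le_iff₀ (by positivity)]
      have h2p : (0 : ℝ) < 2 ^ (2 * n + 5) := by positivity
      nlinarith [mul_pos hε h2p]
    obtain ⟨f, hf, hfe⟩ := ih (contDiffOn_lapC hop hu) h hlo
    obtain ⟨F, hF0, hF, hFe⟩ := exists_solve (c := 0) hf
    have hc : ∀ z ∈ ball (0 : ℂ) R \ {0}, ContDiffAt ℝ 2 u z := fun z hz =>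
      (hu.contDiffAt (hop.mem_nhds hz)).of_le two_le_smooth
    have hP : ∀ z ∈ ball (0 : ℂ) R, ContDiffAt ℝ 2 (PA 0 (n + 1 + 1) F) z := fun z hz =>
      contDiffAt_PA isOpen_ball hz hF
    have hh : HarmonicOnNhd (fun z => u z - PA 0 (n + 1 + 1) F z) (ball 0 R \ {0}) := by
      refine harmonicAt_of_lapC hop
        (fun z hz => ((hc z hz).sub (hP z hz.1)).contDiffWithinAt) fun z hz => ?_
      rw [lapC_sub (hc z hz) (hP z hz.1), hFe z hz.1, hfe z hz, sub_self]
    have hho : (fun z => u z - PA 0 (n + 1 + 1) F z) =o[𝓝[≠] (0 : ℂ)] fun z => Real.log ‖z‖ := by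
      refine IsLittleO.sub ?_ ?_
      · refine ho.trans_isBigO ?_
        have : (fun z : ℂ => ‖z‖ ^ (2 * (n + 1))) =O[𝓝[≠] (0 : ℂ)] fun _ => (1 : ℝ) := by
          have hc : Continuous (fun z : ℂ => ‖z‖ ^ (2 * (n + 1))) := by fun_prop
          exact ((hc.tendsto 0).mono_left nhdsWithin_le_nhds).isBigO_one ℝ
        simpa using this.mul (isBigO_refl (fun z : ℂ => Real.log ‖z‖) (𝓝[≠] 0))
      · have hO : PA 0 (n + 1 + 1) F =O[𝓝[≠] (0 : ℂ)] fun _ => (1 : ℝ) :=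
          ((hP 0 (mem_ball_self hR)).continuousAt.tendsto.mono_left
            nhdsWithin_le_nhds).isBigO_one ℝ
        exact hO.trans_isLittleO
          (isLittleO_const_left.2 (Or.inr (tendsto_abs_atBot_atTop.comp tendsto_log_norm)))
    obtain ⟨H, hH, hHe⟩ := harmonic_removable hR hh hho
    refine ⟨fun j => if j = 0 then H else F j, fun j hj => ?_, fun z hz => ?_⟩
    · by_cases h0 : j = 0
      · simpa [h0] using hH
      · simpa [h0] using hF j hj
    · rw [PA_add_zero hF0, ← hHe z hz]
      ring

end part3

section part4

/-- The identification of `ℂ` with the Euclidean plane. -/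
noncomputable def LC : ℂ ≃ₗᵢ[ℝ] E 2 := Complex.orthonormalBasisOneI.repr

lemma LC_one : LC 1 = EuclideanSpace.single 0 1 := by
  have := Complex.orthonormalBasisOneI.repr_self 0
  simpa [LC] using this

lemma LC_I : LC Complex.I = EuclideanSpace.single 1 1 := by
  have := Complex.orthonormalBasisOneI.repr_self 1
  simpa [LC] using this

lemma fderiv_comp_LC (x₀ : E 2) (f : E 2 → ℝ) (z v : ℂ) :
    fderiv ℝ (fun z => f (x₀ + LC z)) z v = fderiv ℝ f (x₀ + LC z) (LC v) := by
  have h := LC.toContinuousLinearEquiv.comp_right_fderiv (f := fun y => f (x₀ + y)) (x := z)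
  have h1 : fderiv ℝ (fun z => f (x₀ + LC z)) z
      = fderiv ℝ ((fun y => f (x₀ + y)) ∘ LC.toContinuousLinearEquiv) z := rfl
  rw [h1, h, fderiv_comp_add_left]
  rfl

lemma lapC_comp (x₀ : E 2) (f : E 2 → ℝ) :
    lapC (fun z => f (x₀ + LC z)) = fun z => lap f (x₀ + LC z) := by
  funext z
  simp only [lapC, lap, fderiv_comp_LC, Fin.sum_univ_two]
  rw [fderiv_comp_LC x₀ (fun y => fderiv ℝ f y (LC 1)) z 1,
    fderiv_comp_LC x₀ (fun y => fderiv ℝ f y (LC Complex.I)) z Complex.I, LC_one, LC_I]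

lemma lapC_iter_comp (x₀ : E 2) (m : ℕ) (f : E 2 → ℝ) :
    lapC^[m] (fun z => f (x₀ + LC z)) = fun z => lap^[m] f (x₀ + LC z) := by
  induction m generalizing f with
  | zero => rfl
  | succ m ih => rw [Function.iterate_succ_apply, Function.iterate_succ_apply, lapC_comp, ih]

end part4


/-- Theorem 2 (n = 2): if `Δᵐu = 0` on `Ω \ {x₀}` ⊂ ℝ² and
`|u(x)| = o(|x-x₀|^{2m-2} log(1/|x-x₀|))` as `x → x₀`, then `u` has a removable
singularity at `x₀`. -/
theorem polyharmonic_removable_of_littleO_u_dim2 (m : ℕ) (hm : 2 ≤ m)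
    (Ω : Set (E 2)) (hΩ : IsOpen Ω) (hΩc : IsConnected Ω)
    (x₀ : E 2) (hx₀ : x₀ ∈ Ω) (u : E 2 → ℝ)
    (hu : ContDiffOn ℝ (⊤ : ℕ∞) u (Ω \ {x₀}))
    (hpoly : ∀ x ∈ Ω \ {x₀}, lap^[m] u x = 0)
    (ho : u =o[𝓝[≠] x₀] fun x => ‖x - x₀‖ ^ (2 * (m : ℝ) - 2) * Real.log (1 / ‖x - x₀‖)) :
    ∃ δ > 0, closedBall x₀ δ ⊆ Ω ∧
      ∃ v : E 2 → ℝ, ContDiffOn ℝ (⊤ : ℕ∞) v (ball x₀ δ) ∧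
        (∀ x ∈ ball x₀ δ, lap^[m] v x = 0) ∧
        ∀ x ∈ ball x₀ δ \ {x₀}, u x = v x := by
  obtain ⟨δ, hδ, hsub⟩ := Metric.nhds_basis_closedBall.mem_iff.1 (hΩ.mem_nhds hx₀)
  refine ⟨δ, hδ, hsub, ?_⟩
  obtain ⟨n, rfl⟩ : ∃ n, m = n + 1 := ⟨m - 1, by lia⟩
  have hmaps : ∀ z ∈ ball (0 : ℂ) δ \ {0}, x₀ + LC z ∈ Ω \ {x₀} := by
    intro z hz
    refine ⟨hsub ?_, ?_⟩
    · simpa [dist_eq_norm] using (mem_ball_zero_iff.1 hz.1).le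
    · have : z ≠ 0 := hz.2
      simpa using this
  have hA : ContDiff ℝ (⊤ : ℕ∞) (fun z : ℂ => x₀ + LC z) :=
    contDiff_const.add LC.contDiff
  have hU : ContDiffOn ℝ (⊤ : ℕ∞) (fun z => u (x₀ + LC z)) (ball 0 δ \ {0}) :=
    hu.comp hA.contDiffOn hmaps
  have hUo : (fun z => u (x₀ + LC z)) =o[𝓝[≠] (0 : ℂ)]
      fun z => ‖z‖ ^ (2 * n) * Real.log ‖z‖ := by
    have ht : Tendsto (fun z : ℂ => x₀ + LC z) (𝓝[≠] 0) (𝓝[≠] x₀) := by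
      refine tendsto_nhdsWithin_iff.2 ⟨?_, ?_⟩
      · exact (hA.continuous.tendsto' 0 x₀ (by simp)).mono_left nhdsWithin_le_nhds
      · filter_upwards [self_mem_nhdsWithin] with z hz
        have : z ≠ 0 := hz
        simpa using this
    have h1 := ho.comp_tendsto ht
    rw [← isLittleO_neg_right]
    refine h1.congr_right fun z => ?_
    have e : 2 * ((n + 1 : ℕ) : ℝ) - 2 = ((2 * n : ℕ) : ℝ) := by push_cast; ring
    simp only [Function.comp_apply, add_sub_cancel_left, LinearIsometryEquiv.norm_map, e,
      Real.rpow_natCast, one_div, Real.log_inv]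
    ring
  obtain ⟨f, hf, hfe⟩ := punctured_main hδ n hU (fun z hz => by
    rw [lapC_iter_comp]; exact hpoly _ (hmaps z hz)) hUo
  have hinv : ∀ x : E 2, x₀ + LC (LC.symm (x - x₀)) = x := fun x => by simp
  have hball : ∀ x ∈ ball x₀ δ, LC.symm (x - x₀) ∈ ball (0 : ℂ) δ := by
    intro x hx
    rw [mem_ball_zero_iff, LinearIsometryEquiv.norm_map, ← dist_eq_norm]; exact hx
  refine ⟨fun x => PA 0 (n + 1) f (LC.symm (x - x₀)), ?_, ?_, ?_⟩
  · intro x hx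
    have h1 : ContDiffAt ℝ (⊤ : ℕ∞) (fun x : E 2 => LC.symm (x - x₀)) x :=
      (LC.symm.contDiff.comp (contDiff_id.sub contDiff_const)).contDiffAt
    exact (ContDiffAt.comp x (contDiffAt_PA isOpen_ball (hball x hx) hf) h1).contDiffWithinAt
  · intro x hx
    have h1 := congrFun (lapC_iter_comp x₀ (n + 1) (fun x => PA 0 (n + 1) f (LC.symm (x - x₀))))
      (LC.symm (x - x₀))
    rw [hinv] at h1
    rw [← h1]
    simp only [add_sub_cancel_left, LinearIsometryEquiv.symm_apply_apply]
    exact lapC_iter_PA isOpen_ball hf _ (hball x hx)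
  · intro x hx
    have h1 := hfe (LC.symm (x - x₀)) ⟨hball x hx.1, by
      have : x ≠ x₀ := hx.2
      simpa [sub_eq_zero] using this⟩
    rw [hinv] at h1
    exact h1
end
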